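/- arXiv:2503.12272 — 5 statements merged into one kernel-verified Lean document; each statement's English description precedes it below -/
import Mathlib

section
/- Let 0 < α < 2, let c_α = α/(2·Γ(1−α/2)·Γ(1+α/2)), and for r > 0 define s_r : ℝ → ℝ by s_r(u) = c_α·((r² − u²)⁺)^{α/2}. Then for every r > 0 and every u ∈ ℝ with |u| < r, the principal-value integral exists and lim_{ε→0⁺} ∫_{{w ∈ ℝ : |w| > ε}} (s_r(u + w) − s_r(u))·|w|^{−1−α} dw = −1. -/
open MeasureTheory Topology Filter Set

/-- The constant `c_α = α / (2 Γ(1-α/2) Γ(1+α/2))`. -/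
noncomputable def cAlpha (α : ℝ) : ℝ :=
  α / (2 * Real.Gamma (1 - α / 2) * Real.Gamma (1 + α / 2))

/-- The one-dimensional function `s_r(u) = c_α ((r² - u²)⁺)^{α/2}`. -/
noncomputable def sFun (α r : ℝ) (u : ℝ) : ℝ :=
  cAlpha α * (max (r ^ 2 - u ^ 2) 0) ^ (α / 2)


lemma beta_aux (a c : ℝ) (ha0 : 0 < a) (ha1 : a < 1) (hc : 0 < c) :
    IntegrableOn (fun z : ℝ => z ^ (a - 1) / (z + c)) (Ioi 0) ∧
    ∫ z in Ioi (0:ℝ), z ^ (a - 1) / (z + c) = c ^ (a - 1) * (Real.Gamma a * Real.Gamma (1 - a)) := by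
  have hGa := Real.Gamma_pos_of_pos ha0
  have hGb := Real.Gamma_pos_of_pos (show 0 < 1 - a by linarith)
  have e1 : ∀ s ∈ Ioi (0:ℝ), ∫ z in Ioi (0:ℝ), z ^ (a - 1) * Real.exp (-(s * (z + c)))
      = Real.Gamma a * (s ^ ((1 - a) - 1) * Real.exp (-(c * s))) := by
    intro s hs
    have hs' : 0 < s := hs
    have := Real.integral_rpow_mul_exp_neg_mul_Ioi ha0 hs'
    calc _ = ∫ z in Ioi (0:ℝ), (z ^ (a - 1) * Real.exp (-(s * z))) * Real.exp (-(c * s)) := by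
          congr 1; ext z; rw [mul_assoc, ← Real.exp_add]; ring_nf
      _ = _ := by
          rw [integral_mul_const, this, one_div, Real.inv_rpow hs'.le, ← Real.rpow_neg hs'.le]
          ring_nf
  have e2 : ∀ z ∈ Ioi (0:ℝ), ∫ s in Ioi (0:ℝ), z ^ (a - 1) * Real.exp (-(s * (z + c)))
      = z ^ (a - 1) / (z + c) := by
    intro z hz
    have hz' : 0 < z + c := by have : 0 < z := hz; linarith
    have := Real.integral_rpow_mul_exp_neg_mul_Ioi one_pos hz'
    simp only [sub_self, Real.rpow_zero, one_mul, Real.rpow_one, Real.Gamma_one, mul_one] at this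
    rw [integral_const_mul, div_eq_mul_one_div, ← this]
    congr 2; ext s; ring_nf
  have hi1 : ∀ s ∈ Ioi (0:ℝ), IntegrableOn (fun z : ℝ => z ^ (a - 1) * Real.exp (-(s * (z + c)))) (Ioi 0) := by
    intro s hs
    by_contra h
    have h2 := e1 s hs
    rw [integral_undef h] at h2
    have hs' : 0 < s := hs
    have : 0 < Real.Gamma a * (s ^ ((1 - a) - 1) * Real.exp (-(c * s))) := by positivity
    linarith
  have e3 := Real.integral_rpow_mul_exp_neg_mul_Ioi (show 0 < 1 - a by linarith) hc
  have hi2 : IntegrableOn (fun s : ℝ => Real.Gamma a * (s ^ ((1 - a) - 1) * Real.exp (-(c * s)))) (Ioi 0) := by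
    apply Integrable.const_mul
    by_contra h
    rw [integral_undef h] at e3
    have : 0 < (1 / c) ^ (1 - a) * Real.Gamma (1 - a) := by positivity
    linarith
  have hint : Integrable (Function.uncurry fun s z : ℝ => z ^ (a - 1) * Real.exp (-(s * (z + c))))
      ((volume.restrict (Ioi 0)).prod (volume.restrict (Ioi 0))) := by
    rw [integrable_prod_iff]
    · constructor
      · filter_upwards [ae_restrict_mem measurableSet_Ioi] with s hs
        exact hi1 s hs
      · refine hi2.congr ?_
        filter_upwards [ae_restrict_mem measurableSet_Ioi] with s hs
        rw [← e1 s hs]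
        apply setIntegral_congr_fun measurableSet_Ioi
        intro z hz
        have hz' : 0 < z := hz
        simp only [Function.uncurry]
        rw [Real.norm_of_nonneg (by positivity)]
    · apply Measurable.aestronglyMeasurable
      unfold Function.uncurry
      fun_prop
  constructor
  · refine hint.integral_prod_right.congr ?_
    filter_upwards [ae_restrict_mem measurableSet_Ioi] with z hz
    exact e2 z hz
  · have := integral_integral_swap hint
    rw [setIntegral_congr_fun measurableSet_Ioi e1, setIntegral_congr_fun measurableSet_Ioi e2] at this
    rw [← this, integral_const_mul, e3, one_div, Real.inv_rpow hc.le, ← Real.rpow_neg hc.le]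
    ring_nf

lemma rpow_shift_aux (a b : ℝ) (ha0 : 0 < a) (ha1 : a < 1) :
    Tendsto (fun x : ℝ => (x + b) ^ a - x ^ a) atTop (𝓝 0) := by
  have key : ∀ b : ℝ, 0 ≤ b → Tendsto (fun x : ℝ => (x + b) ^ a - x ^ a) atTop (𝓝 0) := by
    intro b hb
    have h0 : Tendsto (fun x : ℝ => a * b * x ^ (-(1 - a))) atTop (𝓝 0) := by
      simpa using (tendsto_rpow_neg_atTop (show 0 < 1 - a by linarith)).const_mul (a * b)
    refine squeeze_zero' ?_ ?_ h0
    · filter_upwards [eventually_gt_atTop 0] with x hx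
      have := Real.rpow_le_rpow hx.le (show x ≤ x + b by linarith) ha0.le
      linarith
    · filter_upwards [eventually_gt_atTop 0] with x hx
      have h1 : x + b = x * (1 + b / x) := by field_simp
      have h3 : 0 ≤ b / x := by positivity
      have h2 := rpow_one_add_le_one_add_mul_self (s := b / x) (by linarith) ha0.le ha1.le
      rw [h1, Real.mul_rpow hx.le (by linarith)]
      have h4 : x ^ (-(1 - a)) = x ^ a / x := by
        rw [neg_sub, Real.rpow_sub_one hx.ne']
      rw [h4]
      have h5 := mul_le_mul_of_nonneg_left h2 (Real.rpow_nonneg hx.le a)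
      have : x ^ a * (1 + a * (b / x)) = x ^ a + a * b * (x ^ a / x) := by field_simp
      linarith
  rcases le_total 0 b with hb | hb
  · exact key b hb
  · have h := (key (-b) (by linarith)).comp (tendsto_atTop_add_const_right atTop b tendsto_id)
    have h' := h.neg
    simp only [neg_zero] at h'
    refine h'.congr ?_
    intro x
    simp

noncomputable def gFun (a r y : ℝ) : ℝ := (max (r ^ 2 - y ^ 2) 0) ^ a

lemma gFun_cont (a r : ℝ) (ha0 : 0 < a) : Continuous (gFun a r) := by
  unfold gFun
  exact Continuous.rpow_const (by fun_prop) (fun x => Or.inr ha0.le)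

lemma sub1_aux (a r u Q : ℝ) (ha0 : 0 < a) (hr : 0 < r) (hu : |u| < r) (hQ : r ≤ Q) :
    ∫ w in ((r ^ 2 - u ^ 2) / (Q + u))..(r - u), gFun a r (u + w) * w ^ (-1 - 2 * a)
      = (r ^ 2 - u ^ 2) ^ (-a) * ∫ q in r..Q, (q ^ 2 - r ^ 2) ^ a / (q + u) := by
  have hu' := abs_lt.1 hu
  have hc : 0 < r ^ 2 - u ^ 2 := by nlinarith
  set c := r ^ 2 - u ^ 2 with hcdef
  have hpos : ∀ q ∈ uIcc r Q, r ≤ q ∧ 0 < q + u := by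
    intro q hq
    rw [uIcc_of_le hQ] at hq
    exact ⟨hq.1, by linarith [hq.1]⟩
  have := intervalIntegral.integral_comp_mul_deriv' (a := r) (b := Q) (f := fun q => c / (q + u))
    (f' := fun q => - c / (q + u) ^ 2) (g := fun w => gFun a r (u + w) * w ^ (-1 - 2 * a))
    (fun q hq => by
      have h := (hpos q hq).2
      have := (hasDerivAt_const q c).div ((hasDerivAt_id q).add_const u) h.ne'
      convert! this using 1
      simp)
    (ContinuousOn.div (by fun_prop) (by fun_prop) (fun q hq => by
      have h := (hpos q hq).2; positivity))
    (by
      apply ContinuousOn.mul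
      · exact ((gFun_cont a r ha0).comp (by fun_prop)).continuousOn
      · apply ContinuousOn.rpow_const continuousOn_id
        rintro x ⟨q, hq, rfl⟩
        have h := (hpos q hq).2
        left; simp only [id]; positivity)
  have hfr : c / (r + u) = r - u := by
    rw [hcdef, div_eq_iff (by linarith)]; ring
  rw [intervalIntegral.integral_symm]
  simp only [hfr] at this
  rw [← this, ← intervalIntegral.integral_neg, ← intervalIntegral.integral_const_mul]
  apply intervalIntegral.integral_congr
  intro q hq
  obtain ⟨h1, h2⟩ := hpos q hq
  have hq2 : 0 ≤ q ^ 2 - r ^ 2 := by nlinarith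
  have e : r ^ 2 - (u + c / (q + u)) ^ 2 = c * (q ^ 2 - r ^ 2) / (q + u) ^ 2 := by
    rw [hcdef]; field_simp; ring
  simp only [Function.comp, gFun]
  rw [e, max_eq_left (by positivity), Real.div_rpow (by positivity) (by positivity),
    Real.mul_rpow hc.le hq2, Real.div_rpow hc.le h2.le,
    show (-1 - 2 * a) = -(1 + a + a) by ring, Real.rpow_neg hc.le, Real.rpow_neg h2.le,
    Real.rpow_add hc, Real.rpow_add hc, Real.rpow_add h2, Real.rpow_add h2, Real.rpow_neg hc.le,
    Real.rpow_one, Real.rpow_one, pow_two (q+u), Real.mul_rpow h2.le h2.le]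
  have := Real.rpow_pos_of_pos hc a
  have := Real.rpow_pos_of_pos h2 a
  field_simp

lemma sub2_aux (a r u Q : ℝ) (ha0 : 0 < a) (hr : 0 < r) (hu : |u| < r) (hQ : r ≤ Q) :
    (∫ q in r..Q, (q ^ 2 - r ^ 2) ^ a / (q + u)) + (∫ q in r..Q, (q ^ 2 - r ^ 2) ^ a / (q + -u))
     = ∫ z in (0:ℝ)..(Q ^ 2 - r ^ 2), z ^ a / (z + (r ^ 2 - u ^ 2)) := by
  have hu' := abs_lt.1 hu
  have hc : 0 < r ^ 2 - u ^ 2 := by nlinarith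
  have hpos : ∀ q ∈ uIcc r Q, r ≤ q ∧ 0 < q + u ∧ 0 < q + -u := by
    intro q hq
    rw [uIcc_of_le hQ] at hq
    exact ⟨hq.1, by linarith [hq.1], by linarith [hq.1]⟩
  have hcn : ContinuousOn (fun q : ℝ => (q ^ 2 - r ^ 2) ^ a) (uIcc r Q) :=
    ContinuousOn.rpow_const (by fun_prop) (fun x _ => Or.inr ha0.le)
  rw [← intervalIntegral.integral_add]
  rotate_left
  · exact (hcn.div (by fun_prop) (fun q hq => (hpos q hq).2.1.ne')).intervalIntegrable
  · exact (hcn.div (by fun_prop) (fun q hq => (hpos q hq).2.2.ne')).intervalIntegrable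
  have := intervalIntegral.integral_comp_mul_deriv' (a := r) (b := Q) (f := fun q => q ^ 2 - r ^ 2)
    (f' := fun q => 2 * q) (g := fun z => z ^ a / (z + (r ^ 2 - u ^ 2)))
    (fun q hq => by
      have := (hasDerivAt_pow 2 q).sub_const (r ^ 2)
      convert! this using 1
      simp)
    (by fun_prop)
    (by
      apply ContinuousOn.div
      · exact ContinuousOn.rpow_const (by fun_prop) (fun x _ => Or.inr ha0.le)
      · fun_prop
      · rintro x ⟨q, hq, rfl⟩
        have h := (hpos q hq)
        have : 0 ≤ q ^ 2 - r ^ 2 := by nlinarith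
        show q ^ 2 - r ^ 2 + _ ≠ 0
        positivity)
  simp only [sub_self] at this
  rw [← this]
  apply intervalIntegral.integral_congr
  intro q hq
  obtain ⟨h1, h2, h3⟩ := hpos q hq
  have e : q ^ 2 - r ^ 2 + (r ^ 2 - u ^ 2) = (q + u) * (q + -u) := by ring
  simp only [Function.comp, e]
  field_simp
  ring

lemma sub3_aux (a c Z : ℝ) (ha0 : 0 < a) (ha1 : a < 1) (hc : 0 < c) (hZ : 0 ≤ Z) :
    ∫ z in (0:ℝ)..Z, z ^ a / (z + c) = Z ^ a / a - c * ∫ z in (0:ℝ)..Z, z ^ (a - 1) / (z + c) := by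
  have h1 : ∫ z in (0:ℝ)..Z, z ^ (a - 1) = Z ^ a / a := by
    rw [integral_rpow (Or.inl (by linarith))]
    simp [Real.zero_rpow ha0.ne']
  rw [← h1, ← intervalIntegral.integral_const_mul, ← intervalIntegral.integral_sub]
  rotate_left
  · exact intervalIntegral.intervalIntegrable_rpow' (by linarith)
  · apply IntervalIntegrable.const_mul
    rw [intervalIntegrable_iff, uIoc_of_le hZ]
    exact (beta_aux a c ha0 ha1 hc).1.mono_set (fun x hx => hx.1)
  apply intervalIntegral.integral_congr_ae
  refine Eventually.of_forall ?_
  intro z hz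
  rw [uIoc_of_le hZ] at hz
  have hz0 : 0 < z := hz.1
  rw [Real.rpow_sub_one hz0.ne']
  field_simp
  ring

lemma gFun_nonneg (a r y : ℝ) : 0 ≤ gFun a r y := Real.rpow_nonneg (le_max_right _ _) _

lemma gFun_le (a r y : ℝ) (ha0 : 0 < a) : gFun a r y ≤ (r ^ 2) ^ a := by
  apply Real.rpow_le_rpow (le_max_right _ _) _ ha0.le
  apply max_le <;> nlinarith [sq_nonneg y, sq_nonneg r]

lemma gFun_neg (a r y : ℝ) : gFun a r (-y) = gFun a r y := by simp [gFun]

lemma gFun_intOn (a r u ε : ℝ) (ha0 : 0 < a) (hε : 0 < ε) :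
    IntegrableOn (fun w : ℝ => gFun a r (u + w) * w ^ (-1 - 2 * a)) (Ioi ε) := by
  refine Integrable.bdd_mul (c := (r ^ 2) ^ a)
    (integrableOn_Ioi_rpow_of_lt (by linarith) hε) ?_ ?_
  · exact ((gFun_cont a r ha0).comp (by fun_prop)).aestronglyMeasurable
  · refine Eventually.of_forall fun w => ?_
    rw [Real.norm_of_nonneg (gFun_nonneg _ _ _)]
    exact gFun_le a r _ ha0

noncomputable def dFun (a r u ε : ℝ) : ℝ :=
  ∫ w in Ioi ε, (gFun a r (u + w) - gFun a r u) * w ^ (-1 - 2 * a)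

lemma h_intOn (a r u ε : ℝ) (ha0 : 0 < a) (hε : 0 < ε) :
    IntegrableOn (fun w : ℝ => (gFun a r (u + w) - gFun a r u) * w ^ (-1 - 2 * a)) (Ioi ε) := by
  simp only [sub_mul]
  exact (gFun_intOn a r u ε ha0 hε).sub
    ((integrableOn_Ioi_rpow_of_lt (by linarith) hε).const_mul _)

lemma dFun_eq (a r u ε : ℝ) (ha0 : 0 < a) (hu : |u| < r) (hε : 0 < ε)
    (hε2 : ε ≤ r - u) :
    dFun a r u ε = (∫ w in ε..(r - u), gFun a r (u + w) * w ^ (-1 - 2 * a))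
      - gFun a r u * (ε ^ (-(2 * a)) / (2 * a)) := by
  unfold dFun
  simp only [sub_mul]
  have hu' := abs_lt.1 hu
  rw [integral_sub (gFun_intOn a r u ε ha0 hε)
    ((integrableOn_Ioi_rpow_of_lt (by linarith) hε).const_mul _), integral_const_mul,
    integral_Ioi_rpow_of_lt (by linarith) hε, intervalIntegral.integral_of_le hε2]
  congr 1
  · apply setIntegral_eq_of_subset_of_forall_sdiff_eq_zero measurableSet_Ioi Ioc_subset_Ioi_self
    rintro w ⟨hw1, hw2⟩
    have hw3 : r - u < w := by
      by_contra h
      exact hw2 ⟨hw1, not_lt.1 h⟩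
    have : gFun a r (u + w) = 0 := by
      unfold gFun
      rw [max_eq_right (by nlinarith), Real.zero_rpow ha0.ne']
    rw [this, zero_mul]
  · rw [show (-1 - 2 * a + 1) = -(2 * a) by ring, neg_div_neg_eq]

lemma dFun_sub (a r u x y : ℝ) (ha0 : 0 < a) (hx : 0 < x) (hy : 0 < y) :
    dFun a r u x - dFun a r u y
      = ∫ w in x..y, (gFun a r (u + w) - gFun a r u) * w ^ (-1 - 2 * a) := by
  unfold dFun
  rw [intervalIntegral.integral_Ioi_sub_Ioi' (h_intOn a r u x ha0 hx) (h_intOn a r u y ha0 hy)]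

lemma gFun_lip (a r u : ℝ) (hu : |u| < r) :
    ∃ L > (0:ℝ), ∃ δ > (0:ℝ), ∀ w, 0 < w → w < δ → |gFun a r (u + w) - gFun a r u| ≤ L * w := by
  have hu' := abs_lt.1 hu
  have hc : 0 < r ^ 2 - u ^ 2 := by nlinarith
  have hd : DifferentiableAt ℝ (gFun a r) u := by
    have h1 : DifferentiableAt ℝ (fun y : ℝ => (r ^ 2 - y ^ 2) ^ a) u := by
      exact DifferentiableAt.rpow_const (f := fun y : ℝ => r ^ 2 - y ^ 2) (by fun_prop) (Or.inl hc.ne')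
    refine h1.congr_of_eventuallyEq ?_
    have : ∀ᶠ y in 𝓝 u, 0 < r ^ 2 - y ^ 2 :=
      (show Continuous (fun y : ℝ => r ^ 2 - y ^ 2) by fun_prop).continuousAt.eventually_const_lt hc
    filter_upwards [this] with y hy
    rw [gFun, max_eq_left hy.le]
  obtain ⟨L, hL, h⟩ := hd.isBigO_sub.exists_pos
  obtain ⟨δ, hδ, h⟩ := Metric.eventually_nhds_iff.1 h.bound
  refine ⟨L, hL, δ, hδ, fun w hw hwd => ?_⟩
  have := h (y := u + w) (by simp [abs_of_pos hw, hwd])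
  simpa [abs_of_pos hw] using this

lemma shift_aux (a r u : ℝ) (ha0 : 0 < a) (ha1 : a < 1) (hu : |u| < r) :
    Tendsto (fun Q : ℝ => dFun a r u ((r ^ 2 - u ^ 2) / Q)
      - dFun a r u ((r ^ 2 - u ^ 2) / (Q + u))) atTop (𝓝 0) := by
  obtain ⟨L, hL, δ, hδ, hlip⟩ := gFun_lip a r u hu
  have hu' := abs_lt.1 hu
  have hc : 0 < r ^ 2 - u ^ 2 := by nlinarith
  set c := r ^ 2 - u ^ 2 with hcdef
  have h0 : Tendsto (fun Q : ℝ => L * (c / 2) ^ (-(2 * a)) * (2 * c * |u|) * Q ^ (-(2 - 2 * a)))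
      atTop (𝓝 0) := by
    simpa using (tendsto_rpow_neg_atTop (show 0 < 2 - 2 * a by linarith)).const_mul
      (L * (c / 2) ^ (-(2 * a)) * (2 * c * |u|))
  refine squeeze_zero_norm' ?_ h0
  filter_upwards [eventually_gt_atTop 0, eventually_gt_atTop (2 * |u|),
    eventually_gt_atTop (2 * c / δ)] with Q hQ0 hQu hQd
  have hau := neg_abs_le u
  have hau2 := le_abs_self u
  have hQ1 : Q / 2 < Q + u := by linarith
  have hQ1' : 0 < Q + u := by linarith
  have hQ2 : Q + u ≤ 2 * Q := by linarith
  rw [dFun_sub a r u _ _ ha0 (by positivity) (by positivity)]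
  have hm : ∀ w ∈ uIoc (c / Q) (c / (Q + u)),
      ‖(gFun a r (u + w) - gFun a r u) * w ^ (-1 - 2 * a)‖ ≤ L * (c / 2 / Q) ^ (-(2 * a)) := by
    intro w hw
    have hw1 : c / 2 / Q ≤ w := by
      have h1 : c / 2 / Q ≤ c / Q := by gcongr; linarith
      have h2 : c / 2 / Q ≤ c / (Q + u) := by
        rw [div_div]; gcongr
      have := hw.1
      exact (le_min h1 h2).trans this.le
    have hw2 : w < δ := by
      have h1 : c / Q ≤ 2 * c / Q := by gcongr; linarith
      have h2 : c / (Q + u) ≤ 2 * c / Q := by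
        rw [div_le_div_iff₀ hQ1' hQ0]; nlinarith
      have h3 : 2 * c / Q < δ := by
        rw [div_lt_iff₀ hQ0]; rw [div_lt_iff₀ hδ] at hQd; linarith
      exact (hw.2.trans (max_le h1 h2)).trans_lt h3
    have hw0 : 0 < w := lt_of_lt_of_le (by positivity) hw1
    rw [norm_mul, Real.norm_eq_abs, Real.norm_of_nonneg (Real.rpow_nonneg hw0.le _)]
    calc _ ≤ (L * w) * w ^ (-1 - 2 * a) := by gcongr; exact hlip w hw0 hw2
      _ = L * w ^ (-(2 * a)) := by
        rw [show -1 - 2 * a = -(2 * a) - 1 by ring, Real.rpow_sub_one hw0.ne']; field_simp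
      _ ≤ _ := by
        have hq : 0 < c / 2 / Q := by positivity
        exact mul_le_mul_of_nonneg_left
          (Real.rpow_le_rpow_of_nonpos hq hw1 (by linarith)) hL.le
  refine (intervalIntegral.norm_integral_le_of_norm_le_const hm).trans ?_
  have hd : |c / (Q + u) - c / Q| ≤ 2 * c * |u| / Q ^ 2 := by
    have : c / (Q + u) - c / Q = - (c * u) / (Q * (Q + u)) := by field_simp; ring
    rw [this, abs_div, abs_neg, abs_mul, abs_of_pos hc, abs_of_pos (show 0 < Q * (Q + u) by positivity),
      div_le_div_iff₀ (by positivity) (by positivity)]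
    have h5 : 0 ≤ c * |u| * Q := by positivity
    nlinarith
  calc _ ≤ L * (c / 2 / Q) ^ (-(2 * a)) * (2 * c * |u| / Q ^ 2) := by gcongr
    _ = _ := by
      rw [Real.div_rpow (by positivity) hQ0.le, show -(2 - 2 * a) = -(-(2 * a)) - (2:ℕ) by push_cast; ring,
        Real.rpow_sub_natCast hQ0.ne', Real.rpow_neg hQ0.le (-(2*a))]
      field_simp

lemma main_aux (a r u : ℝ) (ha0 : 0 < a) (ha1 : a < 1) (hr : 0 < r) (hu : |u| < r) :
    Tendsto (fun Q : ℝ => dFun a r u ((r ^ 2 - u ^ 2) / Q) + dFun a r (-u) ((r ^ 2 - u ^ 2) / Q))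
      atTop (𝓝 (-(Real.Gamma a * Real.Gamma (1 - a)))) := by
  have hu' := abs_lt.1 hu
  have hc : 0 < r ^ 2 - u ^ 2 := by nlinarith
  have hS1 := shift_aux a r u ha0 ha1 hu
  have hS2 := shift_aux a r (-u) ha0 ha1 (by simpa using hu)
  rw [neg_sq] at hS2
  set c := r ^ 2 - u ^ 2 with hcdef
  have hsq : Tendsto (fun Q : ℝ => Q ^ 2 - r ^ 2) atTop atTop :=
    tendsto_atTop_add_const_right _ _ (tendsto_pow_atTop two_ne_zero)
  have hB : Tendsto (fun Q : ℝ => ∫ z in (0:ℝ)..(Q ^ 2 - r ^ 2), z ^ (a - 1) / (z + c)) atTop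
      (𝓝 (c ^ (a - 1) * (Real.Gamma a * Real.Gamma (1 - a)))) := by
    rw [← (beta_aux a c ha0 ha1 hc).2]
    exact intervalIntegral_tendsto_integral_Ioi 0 (beta_aux a c ha0 ha1 hc).1 hsq
  have hR1 : Tendsto (fun Q : ℝ => (Q ^ 2 - r ^ 2) ^ a - (Q ^ 2 - u ^ 2) ^ a) atTop (𝓝 0) := by
    have := ((rpow_shift_aux a c ha0 ha1).comp hsq).neg
    simp only [neg_zero] at this
    refine this.congr fun Q => ?_
    simp only [Function.comp, hcdef]
    ring_nf
  have hR2 : Tendsto (fun Q : ℝ => (Q + u) ^ a - (Q + -u) ^ a) atTop (𝓝 0) := by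
    have := (rpow_shift_aux a u ha0 ha1).sub (rpow_shift_aux a (-u) ha0 ha1)
    simp only [sub_zero] at this
    refine this.congr fun Q => ?_
    ring
  have hT : Tendsto (fun Q : ℝ => c ^ (-a) * ((((Q ^ 2 - r ^ 2) ^ a - (Q ^ 2 - u ^ 2) ^ a)
      - ((Q + u) ^ a - (Q + -u) ^ a) ^ 2 / 2) / a
      - c * ∫ z in (0:ℝ)..(Q ^ 2 - r ^ 2), z ^ (a - 1) / (z + c))) atTop
      (𝓝 (c ^ (-a) * (((0 - 0 ^ 2 / 2) / a) - c * (c ^ (a - 1) * (Real.Gamma a * Real.Gamma (1 - a)))))) :=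
    ((((hR1.sub ((hR2.pow 2).div_const 2)).div_const a)).sub (hB.const_mul c)).const_mul _
  have hfin := (hS1.add hS2).add hT
  have hlim : (0:ℝ) + 0 + c ^ (-a) * (((0 - 0 ^ 2 / 2) / a) - c * (c ^ (a - 1) * (Real.Gamma a * Real.Gamma (1 - a)))) = -(Real.Gamma a * Real.Gamma (1 - a)) := by
    have := Real.rpow_pos_of_pos hc a
    rw [Real.rpow_sub_one hc.ne', Real.rpow_neg hc.le]
    field_simp
    ring
  rw [hlim] at hfin
  refine hfin.congr' ?_
  filter_upwards [eventually_ge_atTop r] with Q hQ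
  have hp1 : 0 < Q + u := by linarith
  have hp2 : 0 < Q + -u := by linarith
  have d1 := dFun_eq a r u (c / (Q + u)) ha0 hu (by positivity) (by
    rw [div_le_iff₀ hp1, hcdef]; nlinarith)
  have d2 := dFun_eq a r (-u) (c / (Q + -u)) ha0 (by simpa using hu) (by positivity) (by
    rw [div_le_iff₀ hp2, hcdef]; nlinarith)
  have s1 := sub1_aux a r u Q ha0 hr hu hQ
  have s2 := sub1_aux a r (-u) Q ha0 hr (by simpa using hu) hQ
  rw [neg_sq] at s2
  have s3 := sub2_aux a r u Q ha0 hr hu hQ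
  have s4 := sub3_aux a c (Q ^ 2 - r ^ 2) ha0 ha1 hc (by nlinarith)
  rw [← hcdef] at s1 s2 s3
  have hg : gFun a r u = c ^ a := by rw [gFun, max_eq_left hc.le]
  have hpw : ∀ x : ℝ, 0 < x → c ^ a * ((c / x) ^ (-(2 * a)) / (2 * a)) = c ^ (-a) * ((x ^ a) ^ 2 / (2 * a)) := by
    intro x hx
    have h1 := Real.rpow_pos_of_pos hc a
    have h2 := Real.rpow_pos_of_pos hx a
    rw [two_mul, Real.rpow_neg (by positivity), Real.rpow_neg hc.le, Real.rpow_add (by positivity),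
      Real.div_rpow hc.le hx.le]
    field_simp
  have hprod : (Q ^ 2 - u ^ 2) ^ a = (Q + u) ^ a * (Q + -u) ^ a := by
    rw [← Real.mul_rpow hp1.le hp2.le]; ring_nf
  have hsum : dFun a r u (c / (Q + u)) + dFun a r (-u) (c / (Q + -u)) =
      c ^ (-a) * ((((Q ^ 2 - r ^ 2) ^ a - (Q ^ 2 - u ^ 2) ^ a)
      - ((Q + u) ^ a - (Q + -u) ^ a) ^ 2 / 2) / a
      - c * ∫ z in (0:ℝ)..(Q ^ 2 - r ^ 2), z ^ (a - 1) / (z + c)) := by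
    rw [d1, d2, s1, s2, gFun_neg, hg, hpw _ hp1, hpw _ hp2, hprod]
    have s5 := s3.trans s4
    have : ∀ A B X Y : ℝ, c ^ (-a) * A - X + (c ^ (-a) * B - Y) = c ^ (-a) * (A + B) - X - Y := by
      intros; ring
    rw [this, s5]
    field_simp
    ring
  linarith

lemma h_intOn_neg (a r u ε : ℝ) (ha0 : 0 < a) (hε : 0 < ε) :
    IntegrableOn (fun w : ℝ => (gFun a r (u + w) - gFun a r u) * |w| ^ (-1 - 2 * a)) (Iio (-ε)) ∧
    ∫ w in Iio (-ε), (gFun a r (u + w) - gFun a r u) * |w| ^ (-1 - 2 * a) = dFun a r (-u) ε := by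
  have hco : EqOn (fun w : ℝ => (gFun a r (-u + w) - gFun a r (-u)) * w ^ (-1 - 2 * a))
      (fun w : ℝ => (gFun a r (u + -w) - gFun a r u) * |-w| ^ (-1 - 2 * a)) (Ioi ε) := by
    intro w hw
    have hw' : 0 < w := hε.trans hw
    have e : -u + w = -(u + -w) := by ring
    simp only [abs_neg, abs_of_pos hw', gFun_neg]
    rw [e, gFun_neg]
  constructor
  · have h1 := (h_intOn a r (-u) ε ha0 hε).congr_fun hco measurableSet_Ioi
    have h2 := ((integrableOn_Ici_iff_integrableOn_Ioi enorm_ne_top).2 h1)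
    rw [← integrableOn_Iic_iff_integrableOn_Iio enorm_ne_top]
    have := (Measure.measurePreserving_neg (volume : Measure ℝ)).integrableOn_comp_preimage
      (Homeomorph.neg ℝ).measurableEmbedding
      (f := fun w : ℝ => (gFun a r (u + w) - gFun a r u) * |w| ^ (-1 - 2 * a)) (s := Iic (-ε))
    rw [← this]
    simpa [Function.comp_def] using h2
  · rw [← integral_Iic_eq_integral_Iio,
      ← integral_comp_neg_Ioi ε (fun w : ℝ => (gFun a r (u + w) - gFun a r u) * |w| ^ (-1 - 2 * a)),
      dFun]
    exact (setIntegral_congr_fun measurableSet_Ioi hco).symm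

lemma total_aux (a r u ε : ℝ) (ha0 : 0 < a) (hε : 0 < ε) :
    IntegrableOn (fun w : ℝ => (gFun a r (u + w) - gFun a r u) * |w| ^ (-1 - 2 * a))
      {w : ℝ | ε < |w|} ∧
    ∫ w in {w : ℝ | ε < |w|}, (gFun a r (u + w) - gFun a r u) * |w| ^ (-1 - 2 * a)
      = dFun a r u ε + dFun a r (-u) ε := by
  have hset : {w : ℝ | ε < |w|} = Ioi ε ∪ Iio (-ε) := by
    ext w
    simp only [mem_ofPred_eq, mem_union, mem_Ioi, mem_Iio, lt_abs]
    constructor <;> (rintro (h | h); exacts [Or.inl h, Or.inr (by linarith)])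
  have hco : EqOn (fun w : ℝ => (gFun a r (u + w) - gFun a r u) * w ^ (-1 - 2 * a))
      (fun w : ℝ => (gFun a r (u + w) - gFun a r u) * |w| ^ (-1 - 2 * a)) (Ioi ε) := by
    intro w hw
    have hw' : 0 < w := hε.trans hw
    simp only [abs_of_pos hw']
  have h1 := (h_intOn a r u ε ha0 hε).congr_fun hco measurableSet_Ioi
  obtain ⟨h2, h3⟩ := h_intOn_neg a r u ε ha0 hε
  rw [hset]
  refine ⟨h1.union h2, ?_⟩
  rw [setIntegral_union _ measurableSet_Iio h1 h2, h3, ← setIntegral_congr_fun measurableSet_Ioi hco]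
  · rfl
  rw [Set.disjoint_left]
  intro w hw hw2
  simp only [mem_Ioi, mem_Iio] at hw hw2
  linarith

/-- Getoor's one-dimensional identity: for `|u| < r`, the principal-value integral
`p.v. ∫ (s_r(u+w) - s_r(u)) |w|^{-1-α} dw` exists and equals `-1`. -/
theorem getoor_one_dim (α : ℝ) (hα0 : 0 < α) (hα2 : α < 2)
    (r u : ℝ) (hr : 0 < r) (hu : |u| < r) :
    (∀ ε > (0 : ℝ), IntegrableOn
        (fun w : ℝ => (sFun α r (u + w) - sFun α r u) * |w| ^ (-1 - α))
        {w : ℝ | ε < |w|}) ∧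
    Tendsto (fun ε : ℝ => ∫ w in {w : ℝ | ε < |w|},
        (sFun α r (u + w) - sFun α r u) * |w| ^ (-1 - α))
      (𝓝[>] 0) (𝓝 (-1)) := by
  obtain ⟨a, rfl⟩ : ∃ a, α = 2 * a := ⟨α / 2, by ring⟩
  have ha0 : 0 < a := by linarith
  have ha1 : a < 1 := by linarith
  have hu' := abs_lt.1 hu
  have hc : 0 < r ^ 2 - u ^ 2 := by nlinarith
  have hG1 := Real.Gamma_pos_of_pos ha0
  have hG2 := Real.Gamma_pos_of_pos (show 0 < 1 - a by linarith)
  have hk : cAlpha (2 * a) = 1 / (Real.Gamma a * Real.Gamma (1 - a)) := by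
    unfold cAlpha
    rw [mul_div_cancel_left₀ a two_ne_zero, add_comm 1 a, Real.Gamma_add_one ha0.ne']
    field_simp
  have hfun : (fun w : ℝ => (sFun (2 * a) r (u + w) - sFun (2 * a) r u) * |w| ^ (-1 - 2 * a))
      = fun w : ℝ => cAlpha (2 * a) *
        ((gFun a r (u + w) - gFun a r u) * |w| ^ (-1 - 2 * a)) := by
    ext w
    simp only [sFun, gFun, mul_div_cancel_left₀ a two_ne_zero]
    ring
  simp only [hfun]
  constructor
  · intro ε hε
    exact (total_aux a r u ε ha0 hε).1.const_mul _
  · simp only [integral_const_mul]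
    have hQ : Tendsto (fun ε : ℝ => (r ^ 2 - u ^ 2) / ε) (𝓝[>] 0) atTop := by
      simp only [div_eq_mul_inv]
      exact tendsto_inv_nhdsGT_zero.const_mul_atTop hc
    have h := ((main_aux a r u ha0 ha1 hr hu).comp hQ).const_mul (cAlpha (2 * a))
    have hl : cAlpha (2 * a) * -(Real.Gamma a * Real.Gamma (1 - a)) = -1 := by
      rw [hk]; field_simp
    rw [hl] at h
    refine h.congr' ?_
    filter_upwards [self_mem_nhdsWithin] with ε hε
    have hε' : 0 < ε := hε
    have e : (r ^ 2 - u ^ 2) / ((r ^ 2 - u ^ 2) / ε) = ε := by field_simp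
    simp only [Function.comp, e, (total_aux a r u ε ha0 hε').2]
end

section
/- Let 0 < α < 2, let c_α = α/(2·Γ(1−α/2)·Γ(1+α/2)), and for r > 0 define s_r : ℝ → ℝ by s_r(u) = c_α·((r² − u²)⁺)^{α/2}. Then the function F : (−r, r) → ℝ given by F(u) = lim_{ε→0⁺} ∫_{{w ∈ ℝ : |w| > ε}} (s_r(u + w) − s_r(u))·|w|^{−1−α} dw is well defined (the limit exists for each u ∈ (−r,r)) and is continuous on (−r, r). -/
open MeasureTheory Topology Filter Set

theorem aux_integrable_comp_abs {f : ℝ → ℝ} (hf : IntegrableOn f (Ioi 0)) :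
    Integrable (fun x : ℝ => f |x|) := by
  have h1 : IntegrableOn (fun x : ℝ => f |x|) (Ioi 0) := by
    refine hf.congr_fun (fun x hx => ?_) measurableSet_Ioi
    rw [abs_of_pos hx]
  have h2 : IntegrableOn (fun x : ℝ => f |x|) (Iic 0) := by
    rw [← Measure.map_neg_eq_self (volume : Measure ℝ)]
    let m : MeasurableEmbedding fun x : ℝ => -x := (Homeomorph.neg ℝ).measurableEmbedding
    rw [m.integrableOn_map_iff]
    simp_rw [Function.comp_def, abs_neg, neg_preimage, neg_Iic, neg_zero]
    exact Iff.mpr integrableOn_Ici_iff_integrableOn_Ioi h1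
  have := h2.union h1
  rwa [Iic_union_Ioi, integrableOn_univ] at this

theorem aux_integrable_far (p : ℝ) (hp : p < -1) (ε : ℝ) (hε : 0 < ε) :
    Integrable ({w : ℝ | ε < |w|}.indicator (fun w => |w| ^ p)) := by
  have h : IntegrableOn ((Ioi ε).indicator (fun t : ℝ => t ^ p)) (Ioi 0) := by
    apply Integrable.integrableOn
    rw [integrable_indicator_iff measurableSet_Ioi]
    exact integrableOn_Ioi_rpow_of_lt hp hε
  refine (aux_integrable_comp_abs h).congr (Eventually.of_forall fun x => ?_)
  simp [indicator]

theorem aux_integrable_near (p : ℝ) (hp : -1 < p) (δ : ℝ) (hδ : 0 < δ) :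
    Integrable ({w : ℝ | |w| ≤ δ}.indicator (fun w => |w| ^ p)) := by
  have h : IntegrableOn ((Iic δ).indicator (fun t : ℝ => t ^ p)) (Ioi 0) := by
    rw [integrableOn_indicator_iff measurableSet_Iic, inter_comm, Ioi_inter_Iic,
      ← intervalIntegrable_iff_integrableOn_Ioc_of_le hδ.le]
    exact intervalIntegral.intervalIntegrable_rpow' hp
  refine (aux_integrable_comp_abs h).congr (Eventually.of_forall fun x => ?_)
  simp [indicator]

/-- Second-difference bound for a `C²` function. -/
theorem aux_second_diff (s : ℝ → ℝ) (r : ℝ) (hs : ContDiffOn ℝ 2 s (Ioo (-r) r))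
    (a : ℝ) (ha : a < r) :
    ∃ M : ℝ, 0 ≤ M ∧ ∀ u w : ℝ, |u| + |w| ≤ a →
      |s (u + w) + s (u - w) - 2 * s u| ≤ M * |w| ^ 2 := by
  have h1 := (contDiffOn_succ_iff_deriv_of_isOpen (n := 1) isOpen_Ioo).1
    (by simpa [one_add_one_eq_two] using hs)
  have hd1 := h1.1
  have h2 := h1.2.2
  have hsub : Icc (-a) a ⊆ Ioo (-r) r := fun x hx => ⟨by linarith [hx.1], by linarith [hx.2]⟩
  have h2d : DifferentiableOn ℝ (deriv s) (Ioo (-r) r) := h2.differentiableOn (by norm_num)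
  have h3 : ContinuousOn (deriv (deriv s)) (Icc (-a) a) :=
    (h2.continuousOn_deriv_of_isOpen isOpen_Ioo le_rfl).mono hsub
  obtain ⟨C, hC⟩ := isCompact_Icc.exists_bound_of_continuousOn h3
  have hCl : ∀ x ∈ Icc (-a) a, ∀ y ∈ Icc (-a) a, |deriv s y - deriv s x| ≤ |C| * |y - x| := by
    intro x hx y hy
    refine (convex_Icc (-a) a).norm_image_sub_le_of_norm_deriv_le (f := deriv s) (fun z hz => ?_)
      (fun z hz => (hC z hz).trans (le_abs_self C)) hx hy
    exact (h2d z (hsub hz)).differentiableAt (isOpen_Ioo.mem_nhds (hsub hz))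
  refine ⟨2 * |C|, by positivity, fun u w huw => ?_⟩
  have hmem : ∀ t ∈ Icc (-|w|) |w|, u + t ∈ Icc (-a) a ∧ u - t ∈ Icc (-a) a := by
    intro t ht
    have h1 := neg_abs_le u
    have h2 := le_abs_self u
    obtain ⟨h3, h4⟩ := ht
    refine ⟨⟨?_, ?_⟩, ⟨?_, ?_⟩⟩ <;> linarith
  have hda : ∀ z ∈ Icc (-a) a, HasDerivAt s (deriv s z) z := fun z hz =>
    ((hd1 z (hsub hz)).differentiableAt (isOpen_Ioo.mem_nhds (hsub hz))).hasDerivAt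
  have hder : ∀ t ∈ Icc (-|w|) |w|,
      HasDerivWithinAt (fun t => s (u + t) + s (u - t)) (deriv s (u + t) - deriv s (u - t))
        (Icc (-|w|) |w|) t := by
    intro t ht
    have e1 := (hda _ (hmem t ht).1).comp t ((hasDerivAt_id t).const_add u)
    have e2 := (hda _ (hmem t ht).2).comp t ((hasDerivAt_id t).const_sub u)
    have e3 := (e1.add e2).hasDerivWithinAt (s := Icc (-|w|) |w|)
    refine (e3.congr_deriv (by ring)).congr_of_mem (fun x _ => ?_) ht
    simp [Function.comp]
  have key := (convex_Icc (-|w|) |w|).norm_image_sub_le_of_norm_hasDerivWithin_le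
    (C := 2 * |C| * |w|) hder (fun t ht => by
      have := hCl _ (hmem t ht).2 _ (hmem t ht).1
      rw [Real.norm_eq_abs]
      refine this.trans ?_
      have e : u + t - (u - t) = 2 * t := by ring
      rw [e, abs_mul, abs_two]
      have : |t| ≤ |w| := abs_le.2 ht
      nlinarith [abs_nonneg C, mul_le_mul_of_nonneg_left this (abs_nonneg C)])
    (x := 0) (y := w) (by simp) ⟨neg_abs_le w, le_abs_self w⟩
  simp only [add_zero, sub_zero, Real.norm_eq_abs] at key
  calc _ = |s (u + w) + s (u - w) - (s u + s u)| := by congr 1; ring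
    _ ≤ _ := key
    _ = _ := by ring

theorem aux_main (α : ℝ) (hα0 : 0 < α) (hα2 : α < 2) (r : ℝ) (s : ℝ → ℝ)
    (hcont : Continuous s) (B : ℝ) (hB : ∀ x, |s x| ≤ B)
    (hs : ContDiffOn ℝ 2 s (Ioo (-r) r)) :
    ∃ F : ℝ → ℝ,
      (∀ u ∈ Set.Ioo (-r) r,
        Tendsto (fun ε : ℝ => ∫ w in {w : ℝ | ε < |w|},
            (s (u + w) - s u) * |w| ^ (-1 - α))
          (𝓝[>] 0) (𝓝 (F u))) ∧
      ContinuousOn F (Set.Ioo (-r) r) := by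
  have hB0 : 0 ≤ B := (abs_nonneg _).trans (hB 0)
  have hmeasS : ∀ ε : ℝ, MeasurableSet {w : ℝ | ε < |w|} := fun ε =>
    measurableSet_lt measurable_const (by fun_prop)
  let G : ℝ → ℝ → ℝ := fun u w => (s (u + w) + s (u - w) - 2 * s u) * |w| ^ (-1 - α) / 2
  have hGm : ∀ u, AEStronglyMeasurable (G u) volume := fun u => by
    have := hcont.measurable
    apply Measurable.aestronglyMeasurable
    fun_prop
  -- local domination
  have hdom : ∀ u₀ ∈ Ioo (-r) r, ∃ bound : ℝ → ℝ, Integrable bound ∧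
      ∀ᶠ u in 𝓝 u₀, ∀ w, ‖G u w‖ ≤ bound w := by
    intro u₀ hu₀
    have hlt : |u₀| < r := abs_lt.2 hu₀
    obtain ⟨δ, hδ, hδe⟩ : ∃ δ : ℝ, 0 < δ ∧ |u₀| + 2 * δ < r :=
      ⟨(r - |u₀|) / 3, by linarith, by linarith⟩
    obtain ⟨M, hM0, hM⟩ := aux_second_diff s r hs (|u₀| + 2 * δ) hδe
    refine ⟨fun w => M * {w : ℝ | |w| ≤ δ}.indicator (fun w => |w| ^ (1 - α)) w +
      (4 * B) * {w : ℝ | δ < |w|}.indicator (fun w => |w| ^ (-1 - α)) w, ?_, ?_⟩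
    · exact ((aux_integrable_near _ (by linarith) δ hδ).const_mul M).add
        ((aux_integrable_far _ (by linarith) δ hδ).const_mul (4 * B))
    · have hev : ∀ᶠ u in 𝓝 u₀, |u| < |u₀| + δ :=
        continuous_abs.continuousAt.eventually_lt continuousAt_const (by linarith)
      filter_upwards [hev] with u hu w
      have hp : 0 ≤ |w| ^ (-1 - α) := Real.rpow_nonneg (abs_nonneg w) _
      have hG : ‖G u w‖ = |s (u + w) + s (u - w) - 2 * s u| * |w| ^ (-1 - α) / 2 := by
        simp only [G, Real.norm_eq_abs, abs_div, abs_mul, abs_two, abs_of_nonneg hp]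
      rw [hG]
      by_cases hw : |w| ≤ δ
      · have hw' : ¬ δ < |w| := not_lt.2 hw
        simp only [indicator, mem_ofPred_eq, hw, hw', if_true, if_false, mul_zero, add_zero]
        rcases eq_or_ne w 0 with rfl | hw0
        · have : s (u + 0) + s (u - 0) - 2 * s u = 0 := by simp; ring
          rw [this]
          simp only [abs_zero, zero_mul, zero_div]
          exact mul_nonneg hM0 (Real.rpow_nonneg le_rfl _)
        have hwp : 0 < |w| := abs_pos.2 hw0
        have e := hM u w (by linarith)
        have e2 : |w| ^ (1 - α) = |w| ^ 2 * |w| ^ (-1 - α) := by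
          rw [← Real.rpow_natCast, ← Real.rpow_add hwp]
          congr 1
          push_cast
          ring
        rw [e2]
        have e3 := mul_le_mul_of_nonneg_right e hp
        have e4 : 0 ≤ |s (u + w) + s (u - w) - 2 * s u| * |w| ^ (-1 - α) :=
          mul_nonneg (abs_nonneg _) hp
        linarith
      · have hw' : δ < |w| := not_le.1 hw
        simp only [indicator, mem_ofPred_eq, hw, hw', if_true, if_false, mul_zero, zero_add]
        have e : |s (u + w) + s (u - w) - 2 * s u| ≤ 4 * B := by
          have h1 := abs_le.1 (hB (u + w))
          have h2 := abs_le.1 (hB (u - w))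
          have h3 := abs_le.1 (hB u)
          rw [abs_le]
          constructor <;> linarith
        have e3 := mul_le_mul_of_nonneg_right e hp
        have e4 : 0 ≤ |s (u + w) + s (u - w) - 2 * s u| * |w| ^ (-1 - α) :=
          mul_nonneg (abs_nonneg _) hp
        linarith
  -- symmetrisation
  have hsym : ∀ u, ∀ ε > 0, ∫ w in {w : ℝ | ε < |w|}, (s (u + w) - s u) * |w| ^ (-1 - α) =
      ∫ w, {w : ℝ | ε < |w|}.indicator (G u) w := by
    intro u ε hε
    let g : ℝ → ℝ := {w : ℝ | ε < |w|}.indicator (fun w => (s (u + w) - s u) * |w| ^ (-1 - α))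
    have hg : Integrable g := by
      refine ((aux_integrable_far (-1 - α) (by linarith) ε hε).const_mul (2 * B)).mono' ?_ ?_
      · have := hcont.measurable
        exact (Measurable.indicator (by fun_prop) (hmeasS ε)).aestronglyMeasurable
      · refine Eventually.of_forall fun w => ?_
        have hp : 0 ≤ |w| ^ (-1 - α) := Real.rpow_nonneg (abs_nonneg w) _
        by_cases hw : ε < |w|
        · simp only [g, indicator, mem_ofPred_eq, hw, if_true, Real.norm_eq_abs, abs_mul,
            abs_of_nonneg hp]
          refine mul_le_mul_of_nonneg_right ?_ hp
          have h1 := abs_le.1 (hB (u + w))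
          have h3 := abs_le.1 (hB u)
          rw [abs_le]
          constructor <;> linarith
        · simp [g, indicator, hw]
    have hgn : Integrable (fun w => g (-w)) := hg.comp_neg
    have e1 : ∫ w, g (-w) = ∫ w, g w := integral_neg_eq_self g volume
    have e2 : ∫ w, {w : ℝ | ε < |w|}.indicator (G u) w = ∫ w, (g w + g (-w)) / 2 := by
      congr 1
      ext w
      by_cases hw : ε < |w|
      · simp only [g, G, indicator, mem_ofPred_eq, hw, if_true, abs_neg, ← sub_eq_add_neg]
        ring
      · simp [g, indicator, hw]
    rw [e2, integral_div, integral_add hg hgn, e1, ← integral_indicator (hmeasS ε)]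
    change ∫ w, g w = _
    ring
  refine ⟨fun u => ∫ w, G u w, fun u hu => ?_, fun u hu => ?_⟩
  · obtain ⟨bound, hb, hev⟩ := hdom u hu
    have hbu := hev.self_of_nhds
    have : Tendsto (fun ε : ℝ => ∫ w, {w : ℝ | ε < |w|}.indicator (G u) w) (𝓝[>] 0)
        (𝓝 (∫ w, G u w)) := by
      refine tendsto_integral_filter_of_dominated_convergence bound ?_ ?_ hb ?_
      · exact Eventually.of_forall fun ε => (hGm u).indicator (hmeasS ε)
      · exact Eventually.of_forall fun ε => Eventually.of_forall fun w =>
          (norm_indicator_le_norm_self _ _).trans (hbu w)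
      · refine Eventually.of_forall fun w => ?_
        rcases eq_or_ne w 0 with rfl | hw0
        · have h0 : G u 0 = 0 := by simp only [G, add_zero, sub_zero]; ring
          have : ∀ ε : ℝ, {w : ℝ | ε < |w|}.indicator (G u) 0 = 0 := fun ε => by
            simp [indicator, h0]
          simp only [this, h0]
          exact tendsto_const_nhds
        · refine tendsto_const_nhds.congr' ?_
          have : ∀ᶠ ε : ℝ in 𝓝[>] 0, ε < |w| :=
            nhdsWithin_le_nhds (eventually_lt_nhds (abs_pos.2 hw0))
          filter_upwards [this] with ε hε
          simp [indicator, hε]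
    refine this.congr' ?_
    filter_upwards [self_mem_nhdsWithin] with ε hε
    exact (hsym u ε hε).symm
  · obtain ⟨bound, hb, hev⟩ := hdom u hu
    refine ContinuousAt.continuousWithinAt ?_
    refine continuousAt_of_dominated (Eventually.of_forall hGm) ?_ hb ?_
    · filter_upwards [hev] with u' hu'
      exact Eventually.of_forall hu'
    · refine Eventually.of_forall fun w => ?_
      simp only [G]
      fun_prop

/-- For `u ∈ (-r, r)`, the principal-value integral
`F(u) = p.v. ∫ (s_r(u+w) - s_r(u)) |w|^{-1-α} dw` is well defined and `F` is
continuous on `(-r, r)`. -/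
theorem pv_integral_continuous (α : ℝ) (hα0 : 0 < α) (hα2 : α < 2)
    (r : ℝ) (hr : 0 < r) :
    ∃ F : ℝ → ℝ,
      (∀ u ∈ Set.Ioo (-r) r,
        Tendsto (fun ε : ℝ => ∫ w in {w : ℝ | ε < |w|},
            (sFun α r (u + w) - sFun α r u) * |w| ^ (-1 - α))
          (𝓝[>] 0) (𝓝 (F u))) ∧
      ContinuousOn F (Set.Ioo (-r) r) := by
  have hα : 0 ≤ α / 2 := by linarith
  refine aux_main α hα0 hα2 r (sFun α r) ?_ (|cAlpha α| * (r ^ 2) ^ (α / 2)) ?_ ?_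
  · unfold sFun
    exact continuous_const.mul
      (Continuous.rpow_const (by fun_prop) fun _ => Or.inr hα)
  · intro x
    unfold sFun
    rw [abs_mul, abs_of_nonneg (Real.rpow_nonneg (le_max_right _ _) _)]
    refine mul_le_mul_of_nonneg_left ?_ (abs_nonneg _)
    refine Real.rpow_le_rpow (le_max_right _ _) (max_le ?_ (sq_nonneg r)) hα
    linarith [sq_nonneg x]
  · have hpos : ∀ x ∈ Ioo (-r) r, 0 < r ^ 2 - x ^ 2 := fun x hx => by
      nlinarith [hx.1, hx.2]
    have h : ContDiffOn ℝ 2 (fun x : ℝ => cAlpha α * (r ^ 2 - x ^ 2) ^ (α / 2)) (Ioo (-r) r) :=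
      contDiffOn_const.mul (ContDiffOn.rpow_const_of_ne (by fun_prop) fun x hx => (hpos x hx).ne')
    refine h.congr fun x hx => ?_
    unfold sFun
    rw [max_eq_left (hpos x hx).le]
end

section
/- Let 0 < α < 2, d ≥ 1, r > 0, let c_α = α/(2·Γ(1−α/2)·Γ(1+α/2)), and define S_r : ℝ^d → ℝ by S_r(x) = c_α·((r² − |x|²)⁺)^{α/2}. Then for every v ∈ ℝ^d and every x ∈ ℝ^d with |x| < r, the principal-value integral exists and lim_{ε→0⁺} ∫_{{w ∈ ℝ : |w| > ε}} (S_r(x + v·w) − S_r(x))·|w|^{−1−α} dw = −|v|^α. -/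
open MeasureTheory Topology Filter Set

/-- The function `S_r(x) = c_α ((r² - |x|²)⁺)^{α/2}` on `ℝ^d`. -/
noncomputable def SFun (α r : ℝ) {d : ℕ} (x : EuclideanSpace ℝ (Fin d)) : ℝ :=
  cAlpha α * (max (r ^ 2 - ‖x‖ ^ 2) 0) ^ (α / 2)

namespace PVaux
open Complex in
lemma ipow_pos (s : ℝ) {y : ℝ} (hy : 0 < y) :
    (I * (y:ℂ)) ^ (s:ℂ) = ((y ^ s : ℝ) : ℂ) * cexp (I * (Real.pi * s / 2 : ℝ)) := by
  have h0 : (I * (y:ℂ)) ≠ 0 := by simp [hy.ne']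
  rw [cpow_def_of_ne_zero h0, mul_comm I, log_ofReal_mul hy I_ne_zero, log_I, add_mul, exp_add,
    ofReal_cpow hy.le, cpow_def_of_ne_zero (by exact_mod_cast hy.ne'), ofReal_log hy.le]
  congr 2
  push_cast; ring

open Complex in
lemma ipow_neg (s : ℝ) {y : ℝ} (hy : 0 < y) :
    (I * ((-y : ℝ):ℂ)) ^ (s:ℂ) = ((y ^ s : ℝ) : ℂ) * cexp (-(I * (Real.pi * s / 2 : ℝ))) := by
  have h0 : ((y:ℂ) * (-I)) ≠ 0 := by simp [hy.ne']
  have h1 : (I * ((-y : ℝ):ℂ)) = (y:ℂ) * (-I) := by push_cast; ring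
  rw [h1, cpow_def_of_ne_zero h0, log_ofReal_mul hy (by simp), log_neg_I, add_mul, exp_add,
    ofReal_cpow hy.le, cpow_def_of_ne_zero (by exact_mod_cast hy.ne'), ofReal_log hy.le]
  congr 2
  push_cast; ring

/-- the holomorphic function. -/
noncomputable def hf (s a b : ℝ) (z : ℂ) : ℂ :=
  (z + Complex.I * b) ^ (s:ℂ) * (z - Complex.I * a) ^ (s:ℂ)

/-- in logarithmic coordinates. -/
noncomputable def Kf (s a b : ℝ) (u : ℂ) : ℂ :=
  hf s a b (Complex.exp u) * Complex.exp (-(2 * s * u))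

/-- one-sided real integrand -/
noncomputable def gf (s a b : ℝ) (t : ℝ) : ℝ :=
  (max ((b - t) * (a + t)) 0) ^ s * t ^ (-1 - 2 * s)

lemma exp_rpow_aux (s x : ℝ) : Real.exp x ^ (-1 - 2 * s) * Real.exp x = Real.exp (-(2 * s * x)) := by
  rw [← Real.exp_mul, ← Real.exp_add]; congr 1; ring

open Complex in
lemma im_bottom (s a b : ℝ) (hs : 0 < s) (ha : 0 < a) (x : ℝ) :
    (Kf s a b (x + ((-(Real.pi/2) : ℝ) : ℂ) * I)).im
      = Real.sin (Real.pi * s) * (gf s a b (Real.exp x) * Real.exp x) := by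
  set t := Real.exp x with ht
  have htp : 0 < t := Real.exp_pos x
  have e1 : cexp (x + ((-(Real.pi/2) : ℝ) : ℂ) * I) = -I * t := by
    rw [exp_add, ht, ofReal_exp]
    have : cexp (((-(Real.pi/2) : ℝ) : ℂ) * I) = -I := by
      push_cast; rw [neg_mul, exp_neg, exp_pi_div_two_mul_I, inv_I]
    rw [this]; ring
  have e2 : cexp (-(2 * s * (x + ((-(Real.pi/2) : ℝ) : ℂ) * I)))
      = ((Real.exp (-(2*s*x)) : ℝ) : ℂ) * cexp (I * (Real.pi * s : ℝ)) := by
    rw [ofReal_exp, ← exp_add]; congr 1; push_cast; ring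
  have e3 : -I * (t:ℂ) + I * b = I * ((b - t : ℝ) : ℂ) := by push_cast; ring
  have e4 : -I * (t:ℂ) - I * a = I * ((-(a + t) : ℝ) : ℂ) := by push_cast; ring
  have e5 := exp_rpow_aux s x
  rw [Kf, hf, e1, e2, e3, e4, ipow_neg s (by positivity : 0 < a + t), gf, mul_assoc (_ ^ s) (t ^ _) t,
    e5]
  rcases lt_trichotomy 0 (b - t) with h | h | h
  · rw [ipow_pos s h, max_eq_left (by positivity), Real.mul_rpow h.le (by positivity)]
    have : ∀ (A B C : ℝ) (E F : ℂ), ((A:ℂ) * E * (B * cexp (-F)) * (C * cexp (I * (Real.pi * s : ℝ))))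
      = ((A * B * C : ℝ) : ℂ) * (E * cexp (-F) * cexp ((Real.pi * s : ℝ) * I)) := by
        intros; push_cast; ring_nf
    rw [this, ← exp_add, add_neg_cancel, exp_zero, one_mul, im_ofReal_mul, exp_ofReal_mul_I_im]
    ring
  · rw [← h]; simp [hs.ne', Real.zero_rpow]
  · have h' : 0 < t - b := by linarith
    rw [max_eq_right (by nlinarith), Real.zero_rpow hs.ne', show b - t = -(t - b) by ring, ipow_neg s h']
    have : ∀ (A B C : ℝ), ((A:ℂ) * cexp (-(I * (Real.pi * s / 2 : ℝ))) * (B * cexp (-(I * (Real.pi * s / 2 : ℝ)))) * (C * cexp (I * (Real.pi * s : ℝ))))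
      = ((A * B * C : ℝ) : ℂ) := by
        intro A B C
        have : cexp (I * (Real.pi * s : ℝ)) = cexp (I * (Real.pi * s / 2 : ℝ)) * cexp (I * (Real.pi * s / 2 : ℝ)) := by
          rw [← exp_add]; congr 1; push_cast; ring
        rw [this, exp_neg]
        have := exp_ne_zero (I * (Real.pi * s / 2 : ℝ))
        field_simp
        push_cast; ring
    rw [this, ofReal_im]; simp

lemma conj_slit {z : ℂ} (hz : 0 ≤ z.re) (s : ℝ) :
    (starRingEnd ℂ z) ^ (s:ℂ) = starRingEnd ℂ (z ^ (s:ℂ)) := by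
  have hz' : z.arg ≠ Real.pi := by
    intro h
    rw [Complex.arg_eq_pi_iff] at h
    linarith [h.1]
  rw [Complex.conj_cpow _ _ hz', Complex.conj_ofReal]

lemma Kf_conj (s a b : ℝ) {u : ℂ} (hu : 0 ≤ (Complex.exp u).re) :
    Kf s a b (starRingEnd ℂ u) = starRingEnd ℂ (Kf s b a u) := by
  have h1 : Complex.exp (starRingEnd ℂ u) + Complex.I * b
    = starRingEnd ℂ (Complex.exp u - Complex.I * b) := by
    simp [Complex.exp_conj]
  have h2 : Complex.exp (starRingEnd ℂ u) - Complex.I * a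
    = starRingEnd ℂ (Complex.exp u + Complex.I * a) := by
    simp [Complex.exp_conj, sub_eq_add_neg]
  have h3 : -(2 * (s:ℂ) * (starRingEnd ℂ u)) = starRingEnd ℂ (-(2 * s * u)) := by
    simp only [map_neg, map_mul, Complex.conj_ofReal, map_ofNat]
  rw [Kf, Kf, hf, hf, h1, h2, h3, conj_slit (by simpa using hu), conj_slit (by simpa using hu),
    Complex.exp_conj]
  simp only [map_mul]; ring

open Complex in
lemma im_top (s a b : ℝ) (hs : 0 < s) (hb : 0 < b) (x : ℝ) :
    (Kf s a b (x + (((Real.pi/2) : ℝ) : ℂ) * I)).im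
      = -(Real.sin (Real.pi * s) * (gf s b a (Real.exp x) * Real.exp x)) := by
  rw [← im_bottom s b a hs hb]
  have : (x + (((Real.pi/2) : ℝ) : ℂ) * I) = starRingEnd ℂ (x + ((-(Real.pi/2) : ℝ) : ℂ) * I) := by
    rw [map_add, map_mul, conj_ofReal, conj_ofReal, conj_I, ofReal_neg]; ring
  rw [this, Kf_conj, conj_im]
  rw [exp_re]; simp

lemma exp_re_nonneg {u : ℂ} (h1 : -(Real.pi/2) ≤ u.im) (h2 : u.im ≤ Real.pi/2) :
    0 ≤ (Complex.exp u).re := by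
  rw [Complex.exp_re]
  have := Real.cos_nonneg_of_mem_Icc ⟨h1, h2⟩
  have := Real.exp_pos u.re
  positivity

lemma Kf_cont (s a b : ℝ) (hs : 0 < s) {u : ℂ} (h : 0 ≤ (Complex.exp u).re) :
    ContinuousAt (Kf s a b) u := by
  unfold Kf hf
  have k1 : ContinuousAt (fun z : ℂ => z ^ (s:ℂ)) (Complex.exp u + Complex.I * b) :=
    Complex.continuousAt_cpow_const_of_re_pos (Or.inl (by simpa using h)) (by simpa using hs)
  have k2 : ContinuousAt (fun z : ℂ => z ^ (s:ℂ)) (Complex.exp u - Complex.I * a) :=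
    Complex.continuousAt_cpow_const_of_re_pos (Or.inl (by simpa using h)) (by simpa using hs)
  have c1 : ContinuousAt (fun u : ℂ => Complex.exp u + Complex.I * b) u := by fun_prop
  have c2 : ContinuousAt (fun u : ℂ => Complex.exp u - Complex.I * a) u := by fun_prop
  have j1 := ContinuousAt.comp (f := fun u : ℂ => Complex.exp u + Complex.I * b) k1 c1
  have j2 := ContinuousAt.comp (f := fun u : ℂ => Complex.exp u - Complex.I * a) k2 c2
  have j3 : ContinuousAt (fun u : ℂ => Complex.exp (-(2 * s * u))) u := by fun_prop
  exact (j1.mul j2).mul j3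

lemma Kf_diff (s a b : ℝ) {u : ℂ} (h : 0 < (Complex.exp u).re) :
    DifferentiableAt ℂ (Kf s a b) u := by
  unfold Kf hf
  have k1 : Complex.exp u + Complex.I * b ∈ Complex.slitPlane := Or.inl (by simpa using h)
  have k2 : Complex.exp u - Complex.I * a ∈ Complex.slitPlane := Or.inl (by simpa using h)
  have j1 : DifferentiableAt ℂ (fun u : ℂ => (Complex.exp u + Complex.I * b) ^ (s:ℂ)) u :=
    DifferentiableAt.cpow_const (by fun_prop) k1
  have j2 : DifferentiableAt ℂ (fun u : ℂ => (Complex.exp u - Complex.I * a) ^ (s:ℂ)) u :=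
    DifferentiableAt.cpow_const (by fun_prop) k2
  have j3 : DifferentiableAt ℂ (fun u : ℂ => Complex.exp (-(2 * s * u))) u := by fun_prop
  exact (j1.mul j2).mul j3

lemma Kf_cont_vert (s a b : ℝ) (hs : 0 < s) (l : ℝ) :
    ContinuousOn (fun y : ℝ => Kf s a b (l + y * Complex.I)) (Icc (-(Real.pi/2)) (Real.pi/2)) := by
  intro y hy
  apply ContinuousAt.continuousWithinAt
  have := Kf_cont s a b hs (u := l + y * Complex.I)
    (exp_re_nonneg (by simpa using hy.1) (by simpa using hy.2))
  exact ContinuousAt.comp (f := fun y : ℝ => (l:ℂ) + y * Complex.I) this (by fun_prop)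

lemma Kf_cont_hor (s a b : ℝ) (hs : 0 < s) (y : ℝ) (h1 : -(Real.pi/2) ≤ y) (h2 : y ≤ Real.pi/2) :
    Continuous (fun x : ℝ => Kf s a b (x + y * Complex.I)) := by
  rw [continuous_iff_continuousAt]
  intro x
  have := Kf_cont s a b hs (u := x + y * Complex.I)
    (exp_re_nonneg (by simpa using h1) (by simpa using h2))
  exact ContinuousAt.comp (f := fun x : ℝ => (x:ℂ) + y * Complex.I) this (by fun_prop)

lemma intervalIntegral_im {f : ℝ → ℂ} {a b : ℝ} (hf : IntervalIntegrable f volume a b) :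
    (∫ x in a..b, f x).im = ∫ x in a..b, (f x).im := by
  have := Complex.imCLM.intervalIntegral_comp_comm hf
  simpa using this.symm

lemma intervalIntegral_re {f : ℝ → ℂ} {a b : ℝ} (hf : IntervalIntegrable f volume a b) :
    (∫ x in a..b, f x).re = ∫ x in a..b, (f x).re := by
  have := Complex.reCLM.intervalIntegral_comp_comm hf
  simpa using this.symm

lemma gf_cont (s a b : ℝ) (hs : 0 < s) : ContinuousOn (gf s a b) (Ioi 0) := by
  unfold gf
  apply ContinuousOn.mul
  · apply ContinuousOn.rpow_const
    · fun_prop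
    · intro x _; right; exact hs.le
  · apply ContinuousOn.rpow_const
    · fun_prop
    · intro x hx; left; exact (ne_of_gt hx)

lemma gf_subst (s a b : ℝ) (hs : 0 < s) (l m : ℝ) :
    ∫ x in l..m, gf s a b (Real.exp x) * Real.exp x
      = ∫ t in (Real.exp l)..(Real.exp m), gf s a b t := by
  refine intervalIntegral.integral_comp_mul_deriv'' (f := Real.exp) (f' := Real.exp) (g := gf s a b)
    (by fun_prop) (fun x _ => (Real.hasDerivAt_exp x).hasDerivWithinAt) (by fun_prop) ?_
  apply (gf_cont s a b hs).mono
  rintro _ ⟨x, _, rfl⟩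
  exact Real.exp_pos x

lemma cauchy (s a b : ℝ) (hs : 0 < s) (ha : 0 < a) (hb : 0 < b) (l m : ℝ) :
    Real.sin (Real.pi * s) * ((∫ t in (Real.exp l)..(Real.exp m), gf s a b t)
      + ∫ t in (Real.exp l)..(Real.exp m), gf s b a t)
    = (∫ y in (-(Real.pi/2))..(Real.pi/2), Kf s a b (l + y * Complex.I)).re
      - (∫ y in (-(Real.pi/2))..(Real.pi/2), Kf s a b (m + y * Complex.I)).re := by
  have hpi := Real.pi_pos
  have H := Complex.integral_boundary_rect_eq_zero_of_continuousOn_of_differentiableOn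
    (Kf s a b) ⟨l, -(Real.pi/2)⟩ ⟨m, Real.pi/2⟩ ?_ ?_
  · simp only at H
    have H2 := congrArg Complex.im H
    simp only [Complex.sub_im, Complex.add_im, smul_eq_mul, Complex.I_mul_im, Complex.zero_im] at H2
    rw [intervalIntegral_im ((Kf_cont_hor s a b hs _ le_rfl (by linarith)).intervalIntegrable _ _),
      intervalIntegral_im ((Kf_cont_hor s a b hs _ (by linarith) le_rfl).intervalIntegrable _ _)] at H2
    simp only [im_bottom s a b hs ha, im_top s a b hs hb] at H2
    rw [intervalIntegral.integral_neg, intervalIntegral.integral_const_mul,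
      intervalIntegral.integral_const_mul, gf_subst s a b hs, gf_subst s b a hs] at H2
    linarith
  · intro u hu
    rw [Complex.mem_reProdIm] at hu
    have h2 := hu.2
    rw [uIcc_of_le (by simp only; linarith)] at h2
    exact (Kf_cont s a b hs (exp_re_nonneg h2.1 h2.2)).continuousWithinAt
  · intro u hu
    rw [Complex.mem_reProdIm] at hu
    have h2 := hu.2
    rw [min_eq_left (by simp only; linarith), max_eq_right (by simp only; linarith)] at h2
    refine (Kf_diff s a b ?_).differentiableWithinAt
    rw [Complex.exp_re]
    exact mul_pos (Real.exp_pos _) (Real.cos_pos_of_mem_Ioo h2)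

lemma scale_cpow {s R : ℝ} (hs : 0 < s) (hR : 0 < R) (z : ℂ) :
    ((R:ℂ) * z) ^ (s:ℂ) = ((R ^ s : ℝ) : ℂ) * z ^ (s:ℂ) := by
  by_cases hz : z = 0
  · have : (s:ℂ) ≠ 0 := by exact_mod_cast hs.ne'
    simp [hz, this]
  · have hR' : (R:ℂ) ≠ 0 := by exact_mod_cast hR.ne'
    rw [Complex.cpow_def_of_ne_zero (mul_ne_zero hR' hz), Complex.log_ofReal_mul hR hz, add_mul,
      Complex.exp_add, Complex.ofReal_cpow hR.le, Complex.cpow_def_of_ne_zero hR',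
      Complex.cpow_def_of_ne_zero hz, Complex.ofReal_log hR.le]

lemma hf_scale {s a b R : ℝ} (hs : 0 < s) (hR : 0 < R) (z : ℂ) :
    hf s a b (R * z) = ((R ^ (2 * s) : ℝ) : ℂ) * hf s (a / R) (b / R) z := by
  have hR' : (R:ℂ) ≠ 0 := by exact_mod_cast hR.ne'
  have h1 : (R:ℂ) * z + Complex.I * b = R * (z + Complex.I * (b / R : ℝ)) := by
    push_cast; field_simp
  have h2 : (R:ℂ) * z - Complex.I * a = R * (z - Complex.I * (a / R : ℝ)) := by
    push_cast; field_simp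
  rw [hf, hf, h1, h2, scale_cpow hs hR, scale_cpow hs hR, two_mul, Real.rpow_add hR]
  push_cast; ring

lemma Kf_vert (s a b : ℝ) (l y : ℝ) :
    Kf s a b (l + y * Complex.I) = ((Real.exp l ^ (-(2 * s)) : ℝ) : ℂ) *
      (hf s a b (Real.exp l * Complex.exp (y * Complex.I)) *
        Complex.exp (((-(2 * s) : ℝ) : ℂ) * Complex.I * y)) := by
  have : Complex.exp (-(2 * s * (l + y * Complex.I))) = ((Real.exp l ^ (-(2 * s)) : ℝ) : ℂ) *
    Complex.exp (((-(2 * s) : ℝ) : ℂ) * Complex.I * y) := by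
    rw [← Real.exp_mul, Complex.ofReal_exp, ← Complex.exp_add]; congr 1; push_cast; ring
  rw [Kf, this, Complex.exp_add, Complex.ofReal_exp]
  ring

lemma Kf_vert' {s a b : ℝ} (hs : 0 < s) (l y : ℝ) :
    Kf s a b (l + y * Complex.I) = hf s (a / Real.exp l) (b / Real.exp l) (Complex.exp (y * Complex.I)) *
        Complex.exp (((-(2 * s) : ℝ) : ℂ) * Complex.I * y) := by
  rw [Kf_vert, hf_scale hs (Real.exp_pos l), ← mul_assoc, ← mul_assoc, ← Complex.ofReal_mul,
    ← Real.rpow_add (Real.exp_pos l)]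
  simp

lemma hf_norm_le {s a b : ℝ} (hs : 0 < s) (ha : 0 ≤ a) (hb : 0 ≤ b) {z : ℂ} (hz : ‖z‖ = 1) :
    ‖hf s a b z‖ ≤ (1 + b) ^ s * (1 + a) ^ s := by
  rw [hf, norm_mul, Complex.norm_cpow_real, Complex.norm_cpow_real]
  have h1 : ‖z + Complex.I * b‖ ≤ 1 + b := by
    refine (norm_add_le _ _).trans ?_
    simp [hz, abs_of_nonneg hb]
  have h2 : ‖z - Complex.I * a‖ ≤ 1 + a := by
    refine (norm_sub_le _ _).trans ?_
    simp [hz, abs_of_nonneg ha]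
  gcongr

lemma right_lim (s a b : ℝ) (hs : 0 < s) (ha : 0 < a) (hb : 0 < b) :
    Tendsto (fun m : ℝ => ∫ y in (-(Real.pi/2))..(Real.pi/2), Kf s a b (m + y * Complex.I))
      atTop (𝓝 (Real.pi : ℂ)) := by
  have hpi := Real.pi_pos
  have key : Tendsto (fun m : ℝ => ∫ y in (-(Real.pi/2))..(Real.pi/2), Kf s a b (m + y * Complex.I))
      atTop (𝓝 (∫ y in (-(Real.pi/2))..(Real.pi/2), (1:ℂ))) := by
    apply intervalIntegral.tendsto_integral_filter_of_dominated_convergence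
      (fun _ => (1 + b) ^ s * (1 + a) ^ s)
    · refine Eventually.of_forall fun m => ?_
      rw [uIoc_of_le (by linarith)]
      exact ((Kf_cont_vert s a b hs m).mono Ioc_subset_Icc_self).aestronglyMeasurable measurableSet_Ioc
    · filter_upwards [eventually_ge_atTop 0] with m hm
      refine Eventually.of_forall fun y _ => ?_
      have h1 : 1 ≤ Real.exp m := Real.one_le_exp hm
      rw [Kf_vert' hs, norm_mul]
      have : ‖Complex.exp (((-(2 * s) : ℝ) : ℂ) * Complex.I * y)‖ = 1 := by
        rw [Complex.norm_exp]; simp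
      rw [this, mul_one]
      refine (hf_norm_le hs (by positivity) (by positivity) (Complex.norm_exp_ofReal_mul_I y)).trans ?_
      have := div_le_self ha.le h1
      have := div_le_self hb.le h1
      gcongr
    · exact intervalIntegrable_const
    · refine Eventually.of_forall fun y hy => ?_
      rw [uIoc_of_le (by linarith)] at hy
      simp only [Kf_vert' hs]
      set z := Complex.exp (y * Complex.I) with hz
      have hzre : 0 ≤ z.re := by
        apply exp_re_nonneg <;> simp
        · linarith [hy.1]
        · linarith [hy.2]
      have hzs : z ^ (s:ℂ) = Complex.exp (s * Complex.I * y) := by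
        rw [Complex.cpow_def_of_ne_zero (Complex.exp_ne_zero _), Complex.log_exp]
        · congr 1; ring
        · simp; linarith [hy.1]
        · simp; linarith [hy.2]
      have hk : ContinuousAt (fun z : ℂ => z ^ (s:ℂ)) z :=
        Complex.continuousAt_cpow_const_of_re_pos (Or.inl hzre) (by simpa using hs)
      have hd : ∀ c : ℝ, Tendsto (fun m : ℝ => ((c / Real.exp m : ℝ) : ℂ)) atTop (𝓝 0) := by
        intro c
        have : Tendsto (fun m : ℝ => c / Real.exp m) atTop (𝓝 0) :=
          tendsto_const_nhds.div_atTop Real.tendsto_exp_atTop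
        exact (Complex.continuous_ofReal.tendsto 0).comp this
      have t1 : Tendsto (fun m : ℝ => z + Complex.I * ((b / Real.exp m : ℝ) : ℂ)) atTop (𝓝 z) := by
        simpa using tendsto_const_nhds.add ((hd b).const_mul Complex.I)
      have t2 : Tendsto (fun m : ℝ => z - Complex.I * ((a / Real.exp m : ℝ) : ℂ)) atTop (𝓝 z) := by
        simpa using tendsto_const_nhds.sub ((hd a).const_mul Complex.I)
      have t3 := ((hk.tendsto.comp t1).mul (hk.tendsto.comp t2)).mul_const
        (Complex.exp (((-(2 * s) : ℝ) : ℂ) * Complex.I * y))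
      have e : z ^ (s:ℂ) * z ^ (s:ℂ) * Complex.exp (((-(2 * s) : ℝ) : ℂ) * Complex.I * y) = 1 := by
        rw [hzs, ← Complex.exp_add, ← Complex.exp_add, ← Complex.exp_zero]
        congr 1; push_cast; ring
      rw [e] at t3
      exact t3
  convert key using 2
  rw [intervalIntegral.integral_const]
  simp

lemma hf_zero {s a b : ℝ} (ha : 0 < a) (hb : 0 < b) :
    hf s a b 0 = (((a * b) ^ s : ℝ) : ℂ) := by
  have h1 : (0:ℂ) + Complex.I * b = Complex.I * b := by ring
  have h2 : (0:ℂ) - Complex.I * a = Complex.I * ((-a : ℝ) : ℂ) := by push_cast; ring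
  rw [hf, h1, h2, ipow_pos s hb, ipow_neg s ha, Complex.exp_neg, Real.mul_rpow ha.le hb.le]
  have := Complex.exp_ne_zero (Complex.I * (Real.pi * s / 2 : ℝ))
  field_simp
  push_cast; ring

lemma hf_taylor {s a b : ℝ} (ha : 0 < a) (hb : 0 < b) :
    ∃ κ : ℝ, ∃ C η : ℝ, 0 < C ∧ 0 < η ∧ ∀ z : ℂ, ‖z‖ < η →
      ‖hf s a b z - (((a * b) ^ s : ℝ) : ℂ) - (κ : ℂ) * Complex.I * z‖ ≤ C * ‖z‖ ^ 2 := by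
  have ha' : (a:ℂ) ≠ 0 := by exact_mod_cast ha.ne'
  have hb' : (b:ℂ) ≠ 0 := by exact_mod_cast hb.ne'
  have k1 : (0:ℂ) + Complex.I * b ∈ Complex.slitPlane := Or.inr (by simpa using hb.ne')
  have k2 : (0:ℂ) - Complex.I * a ∈ Complex.slitPlane := Or.inr (by simpa using ha.ne')
  have han : AnalyticAt ℂ (hf s a b) 0 := by
    unfold hf
    apply AnalyticAt.mul
    · exact AnalyticAt.cpow (by fun_prop) (by fun_prop) k1
    · exact AnalyticAt.cpow (by fun_prop) (by fun_prop) k2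
  have hder : HasDerivAt (hf s a b) (((s * (a * b) ^ s * (1 / a - 1 / b) : ℝ) : ℂ) * Complex.I) 0 := by
    have d1 : HasDerivAt (fun z : ℂ => (z + Complex.I * b) ^ (s:ℂ)) _ 0 :=
      ((hasDerivAt_id (0:ℂ)).add_const (Complex.I * b)).cpow_const (c := s) k1
    have d2 : HasDerivAt (fun z : ℂ => (z - Complex.I * a) ^ (s:ℂ)) _ 0 :=
      ((hasDerivAt_id (0:ℂ)).sub_const (Complex.I * a)).cpow_const (c := s) k2
    have d3 := d1.mul d2
    have h0 := hf_zero (s := s) ha hb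
    rw [hf] at h0
    refine HasDerivAt.congr_deriv d3 ?_
    simp only [id]
    rw [Complex.cpow_sub _ _ (Complex.slitPlane_ne_zero k1), Complex.cpow_sub _ _ (Complex.slitPlane_ne_zero k2),
      Complex.cpow_one, Complex.cpow_one]
    have : ∀ X Y : ℂ, (s:ℂ) * (X / (0 + Complex.I * b)) * 1 * Y + X * (s * (Y / (0 - Complex.I * a)) * 1)
      = s * (X * Y) * (1 / a - 1 / b) * Complex.I := by
      intro X Y
      have hI := Complex.I_ne_zero
      have e1 : X / (0 + Complex.I * b) = - Complex.I * X / b := by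
        rw [div_eq_div_iff (by simpa using hb') hb']
        linear_combination (X * b) * Complex.I_sq
      have e2 : Y / (0 - Complex.I * a) = Complex.I * Y / a := by
        rw [div_eq_div_iff (by simpa using ha') ha']
        linear_combination (Y * a) * Complex.I_sq
      rw [e1, e2]
      ring
    rw [this, h0]
    push_cast; ring
  obtain ⟨p, hp⟩ := han
  have hO := hp.isBigO_sub_partialSum_pow 2
  obtain ⟨C, hC, hO⟩ := hO.exists_pos
  rw [Asymptotics.IsBigOWith, Metric.eventually_nhds_iff] at hO
  obtain ⟨η, hη, hO⟩ := hO
  refine ⟨s * (a * b) ^ s * (1 / a - 1 / b), C, η, hC, hη, fun z hz => ?_⟩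
  have := hO (y := z) (by simpa using hz)
  have e : p.partialSum 2 z = (((a * b) ^ s : ℝ) : ℂ) +
      ((s * (a * b) ^ s * (1 / a - 1 / b) : ℝ) : ℂ) * Complex.I * z := by
    rw [FormalMultilinearSeries.partialSum, Finset.sum_range_succ, Finset.sum_range_one,
      hp.coeff_zero, hf_zero ha hb]
    congr 1
    have h1 := hp.deriv
    rw [hder.deriv] at h1
    rw [h1, FormalMultilinearSeries.apply_eq_pow_smul_coeff]
    rw [pow_one, smul_eq_mul, mul_comm]; rfl
  rw [e, zero_add, ← sub_sub] at this
  simpa using this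

lemma int_exp_im (c : ℝ) :
    (∫ y in (-(Real.pi/2))..(Real.pi/2), Complex.exp ((c:ℂ) * Complex.I * y)).im = 0 := by
  rw [intervalIntegral_im (Continuous.intervalIntegrable (by fun_prop) _ _)]
  have : ∀ y : ℝ, (Complex.exp ((c:ℂ) * Complex.I * y)).im = Real.sin (c * y) := by
    intro y
    rw [← Complex.exp_ofReal_mul_I_im]; congr 2; push_cast; ring
  simp only [this]
  have h := intervalIntegral.integral_comp_neg (a := -(Real.pi/2)) (b := Real.pi/2) (fun y => Real.sin (c * y))
  simp only [mul_neg, Real.sin_neg, neg_neg, intervalIntegral.integral_neg] at h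
  linarith

lemma int_exp_re {s : ℝ} (hs : 0 < s) :
    (∫ y in (-(Real.pi/2))..(Real.pi/2), Complex.exp (((-(2 * s) : ℝ):ℂ) * Complex.I * y)).re
      = Real.sin (Real.pi * s) / s := by
  rw [intervalIntegral_re (Continuous.intervalIntegrable (by fun_prop) _ _)]
  have : ∀ y : ℝ, (Complex.exp (((-(2 * s) : ℝ):ℂ) * Complex.I * y)).re = Real.cos ((2 * s) * y) := by
    intro y
    rw [← Real.cos_neg, ← Complex.exp_ofReal_mul_I_re]; congr 2; push_cast; ring
  simp only [this]
  rw [intervalIntegral.integral_comp_mul_left (fun y => Real.cos y) (by positivity), integral_cos]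
  rw [show 2 * s * -(Real.pi / 2) = -(Real.pi * s) by ring, show 2 * s * (Real.pi / 2) = Real.pi * s by ring,
    Real.sin_neg, smul_eq_mul]
  field_simp
  ring

lemma left_lim (s a b : ℝ) (hs : 0 < s) (hs1 : s < 1) (ha : 0 < a) (hb : 0 < b) :
    Tendsto (fun ε : ℝ =>
      (∫ y in (-(Real.pi/2))..(Real.pi/2), Kf s a b (Real.log ε + y * Complex.I)).re
        - Real.sin (Real.pi * s) * ((a * b) ^ s * (ε ^ (-(2 * s)) / s)))
      (𝓝[>] 0) (𝓝 0) := by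
  have hpi := Real.pi_pos
  obtain ⟨κ, C, η, hC, hη, hT⟩ := hf_taylor (s := s) ha hb
  have hlim : Tendsto (fun ε : ℝ => C * ε ^ (2 - 2 * s) * Real.pi) (𝓝[>] 0) (𝓝 0) := by
    have : Tendsto (fun ε : ℝ => C * ε ^ (2 - 2 * s) * Real.pi) (𝓝[>] 0)
        (𝓝 (C * 0 ^ (2 - 2 * s) * Real.pi)) := by
      apply Tendsto.mono_left _ nhdsWithin_le_nhds
      apply Tendsto.mul_const
      apply Tendsto.const_mul
      exact (Real.continuousAt_rpow_const 0 (2 - 2 * s) (Or.inr (by linarith))).tendsto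
    rwa [Real.zero_rpow (by linarith), mul_zero, zero_mul] at this
  refine squeeze_zero_norm' ?_ hlim
  filter_upwards [Ioo_mem_nhdsGT hη] with ε hε
  have hε0 : 0 < ε := hε.1
  set E : ℝ → ℂ := fun y => ((ε ^ (-(2 * s)) : ℝ) : ℂ) *
    ((((a * b) ^ s : ℝ) : ℂ) * Complex.exp (((-(2 * s) : ℝ):ℂ) * Complex.I * y)
      + ((κ * ε : ℝ) : ℂ) * Complex.I * Complex.exp (((1 - 2 * s : ℝ):ℂ) * Complex.I * y)) with hE
  have hEc : Continuous E := by fun_prop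
  have hEre : (∫ y in (-(Real.pi/2))..(Real.pi/2), E y).re
      = Real.sin (Real.pi * s) * ((a * b) ^ s * (ε ^ (-(2 * s)) / s)) := by
    simp only [hE]
    rw [intervalIntegral.integral_const_mul, intervalIntegral.integral_add
      (Continuous.intervalIntegrable (by fun_prop) _ _) (Continuous.intervalIntegrable (by fun_prop) _ _),
      intervalIntegral.integral_const_mul, intervalIntegral.integral_const_mul,
      Complex.re_ofReal_mul, Complex.add_re, Complex.re_ofReal_mul, int_exp_re hs, mul_assoc,
      Complex.re_ofReal_mul, Complex.I_mul_re, int_exp_im]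
    field_simp
    ring
  rw [← hEre, ← Complex.sub_re, ← intervalIntegral.integral_sub _ (hEc.intervalIntegrable _ _)]
  · rw [Real.norm_eq_abs]
    refine (Complex.abs_re_le_norm _).trans ?_
    have := intervalIntegral.norm_integral_le_of_norm_le_const (a := -(Real.pi/2)) (b := Real.pi/2)
      (f := fun y : ℝ => Kf s a b (Real.log ε + y * Complex.I) - E y) (C := C * ε ^ (2 - 2 * s)) ?_
    · rwa [show Real.pi / 2 - -(Real.pi / 2) = Real.pi by ring, abs_of_pos hpi] at this
    · intro y _
      have hn : ‖(ε:ℂ) * Complex.exp (y * Complex.I)‖ = ε := by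
        rw [norm_mul, Complex.norm_exp_ofReal_mul_I]; simp [abs_of_pos hε0]
      have h1 := hT (ε * Complex.exp (y * Complex.I)) (by rw [hn]; exact hε.2)
      rw [hn] at h1
      have e1 : Complex.exp (((1 - 2 * s : ℝ):ℂ) * Complex.I * y) = Complex.exp (y * Complex.I) *
          Complex.exp (((-(2 * s) : ℝ):ℂ) * Complex.I * y) := by
        rw [← Complex.exp_add]; congr 1; push_cast; ring
      have e2 : Kf s a b (Real.log ε + y * Complex.I) - E y = ((ε ^ (-(2 * s)) : ℝ) : ℂ) *
        ((hf s a b (ε * Complex.exp (y * Complex.I)) - (((a * b) ^ s : ℝ) : ℂ)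
          - (κ : ℂ) * Complex.I * (ε * Complex.exp (y * Complex.I))) *
          Complex.exp (((-(2 * s) : ℝ):ℂ) * Complex.I * y)) := by
        rw [Kf_vert, Real.exp_log hε0]
        simp only [hE]
        rw [e1]; push_cast; ring
      rw [e2, norm_mul, norm_mul]
      have : ‖Complex.exp (((-(2 * s) : ℝ) : ℂ) * Complex.I * y)‖ = 1 := by
        rw [Complex.norm_exp]; simp
      rw [this, mul_one, Complex.norm_real, Real.norm_eq_abs, abs_of_pos (by positivity)]
      calc ε ^ (-(2 * s)) * _ ≤ ε ^ (-(2 * s)) * (C * ε ^ 2) := by gcongr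
        _ = C * ε ^ (2 - 2 * s) := by
          rw [show (2 - 2 * s) = -(2 * s) + 2 by ring, Real.rpow_add hε0, Real.rpow_two]; ring
  · refine ContinuousOn.intervalIntegrable ?_
    rw [uIcc_of_le (by linarith)]
    exact Kf_cont_vert s a b hs _

lemma gf_int {s a b ε : ℝ} (hs : 0 < s) (ha : 0 < a) (hb : 0 < b) (hε : 0 < ε) :
    IntegrableOn (gf s a b) (Ioi ε) := by
  have h1 : IntegrableOn (fun t : ℝ => ((a + b) ^ 2) ^ s * t ^ (-1 - 2 * s)) (Ioi ε) :=
    (integrableOn_Ioi_rpow_of_lt (by linarith) hε).const_mul _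
  refine Integrable.mono' h1 ?_ ?_
  · exact ((gf_cont s a b hs).mono (Ioi_subset_Ioi hε.le)).aestronglyMeasurable measurableSet_Ioi
  · rw [ae_restrict_iff' measurableSet_Ioi]
    refine Eventually.of_forall fun t ht => ?_
    have ht0 : 0 < t := hε.trans ht
    have hnn : 0 ≤ gf s a b t := by unfold gf; positivity
    rw [Real.norm_eq_abs, abs_of_nonneg hnn, gf]
    gcongr
    apply max_le _ (by positivity)
    nlinarith [sq_nonneg t, mul_pos ha hb, mul_pos ha ht0, mul_pos hb ht0, sq_nonneg (a+b), sq_nonneg (b-t)]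

/-- The full-line one-dimensional integrand. -/
noncomputable def Ff (s a b w : ℝ) : ℝ :=
  ((max ((b - w) * (a + w)) 0) ^ s - (a * b) ^ s) * |w| ^ (-1 - 2 * s)

lemma Ff_pos {s a b w : ℝ} (hw : 0 < w) :
    Ff s a b w = gf s a b w - (a * b) ^ s * w ^ (-1 - 2 * s) := by
  rw [Ff, gf, abs_of_pos hw]; ring

lemma Ff_neg (s a b w : ℝ) : Ff s a b (-w) = Ff s b a w := by
  rw [Ff, Ff, abs_neg, mul_comm a b]; congr 4; ring

lemma Ff_int {s a b ε : ℝ} (hs : 0 < s) (ha : 0 < a) (hb : 0 < b) (hε : 0 < ε) :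
    IntegrableOn (Ff s a b) (Ioi ε) ∧ ∫ w in Ioi ε, Ff s a b w
      = (∫ w in Ioi ε, gf s a b w) - (a * b) ^ s * (ε ^ (-(2 * s)) / (2 * s)) := by
  have h1 := gf_int hs ha hb hε
  have h2 : IntegrableOn (fun t : ℝ => (a * b) ^ s * t ^ (-1 - 2 * s)) (Ioi ε) :=
    (integrableOn_Ioi_rpow_of_lt (by linarith) hε).const_mul _
  have e : EqOn (Ff s a b) (fun w => gf s a b w - (a * b) ^ s * w ^ (-1 - 2 * s)) (Ioi ε) :=
    fun w hw => Ff_pos (hε.trans hw)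
  refine ⟨IntegrableOn.congr_fun (h1.sub h2) e.symm measurableSet_Ioi, ?_⟩
  rw [setIntegral_congr_fun measurableSet_Ioi e, integral_sub h1 h2, integral_const_mul,
    integral_Ioi_rpow_of_lt (by linarith) hε, show -1 - 2 * s + 1 = -(2 * s) by ring, neg_div_neg_eq]

lemma set_eq (ε : ℝ) : {w : ℝ | ε < |w|} = Iio (-ε) ∪ Ioi ε := by
  ext w
  simp only [mem_setOf_eq, lt_abs, mem_union, mem_Iio, mem_Ioi]
  constructor
  · rintro (h | h)
    · exact Or.inr h
    · left; linarith
  · rintro (h | h)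
    · right; linarith
    · exact Or.inl h

lemma Ff_full {s a b ε : ℝ} (hs : 0 < s) (ha : 0 < a) (hb : 0 < b) (hε : 0 < ε) :
    IntegrableOn (Ff s a b) {w : ℝ | ε < |w|} ∧ ∫ w in {w : ℝ | ε < |w|}, Ff s a b w
      = (∫ w in Ioi ε, gf s a b w) + (∫ w in Ioi ε, gf s b a w)
        - (a * b) ^ s * (ε ^ (-(2 * s)) / s) := by
  obtain ⟨i1, v1⟩ := Ff_int hs ha hb hε
  obtain ⟨i2, v2⟩ := Ff_int hs hb ha hε
  have i3 : IntegrableOn (Ff s a b) (Iio (-ε)) := by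
    have := ((Measure.measurePreserving_neg (volume : Measure ℝ)).integrableOn_comp_preimage
      (MeasurableEquiv.neg ℝ).measurableEmbedding (f := Ff s a b) (s := Iio (-ε)))
    rw [← this]
    have e : (Neg.neg ⁻¹' (Iio (-ε)) : Set ℝ) = Ioi ε := by ext; simp
    rw [e]
    refine i2.congr_fun (fun w _ => ?_) measurableSet_Ioi
    exact (Ff_neg s a b w).symm
  have v3 : ∫ w in Iio (-ε), Ff s a b w = ∫ w in Ioi ε, Ff s b a w := by
    rw [← integral_Iic_eq_integral_Iio, ← integral_comp_neg_Ioi]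
    simp only [Ff_neg]
  rw [set_eq]
  refine ⟨i3.union i1, ?_⟩
  rw [setIntegral_union _ measurableSet_Ioi i3 i1, v3, v1, v2, mul_comm b a]
  · field_simp; ring
  · rw [Set.disjoint_left]
    intro w h1 h2
    simp only [mem_Iio, mem_Ioi] at h1 h2
    linarith

lemma gf_value {s a b ε : ℝ} (hs : 0 < s) (ha : 0 < a) (hb : 0 < b) (hε : 0 < ε) :
    Real.sin (Real.pi * s) * ((∫ w in Ioi ε, gf s a b w) + (∫ w in Ioi ε, gf s b a w))
    = (∫ y in (-(Real.pi/2))..(Real.pi/2), Kf s a b (Real.log ε + y * Complex.I)).re - Real.pi := by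
  have c := cauchy s a b hs ha hb (Real.log ε)
  rw [Real.exp_log hε] at c
  have t1 := intervalIntegral_tendsto_integral_Ioi ε (gf_int hs ha hb hε) Real.tendsto_exp_atTop
  have t2 := intervalIntegral_tendsto_integral_Ioi ε (gf_int hs hb ha hε) Real.tendsto_exp_atTop
  have t3 := (t1.add t2).const_mul (Real.sin (Real.pi * s))
  have t4 := (Complex.continuous_re.tendsto _).comp (right_lim s a b hs ha hb)
  have t5 := t4.const_sub
    (∫ y in (-(Real.pi/2))..(Real.pi/2), Kf s a b (Real.log ε + y * Complex.I)).re
  refine tendsto_nhds_unique t3 (Tendsto.congr (fun m => ?_) t5)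
  exact (c m).symm

lemma Ff_lim {s a b : ℝ} (hs : 0 < s) (hs1 : s < 1) (ha : 0 < a) (hb : 0 < b) :
    Tendsto (fun ε : ℝ => ∫ w in {w : ℝ | ε < |w|}, Ff s a b w) (𝓝[>] 0)
      (𝓝 (-(Real.pi / Real.sin (Real.pi * s)))) := by
  have hpi := Real.pi_pos
  have hsin : 0 < Real.sin (Real.pi * s) :=
    Real.sin_pos_of_pos_of_lt_pi (by positivity) (by nlinarith)
  have t := ((left_lim s a b hs hs1 ha hb).sub_const Real.pi).div_const (Real.sin (Real.pi * s))
  rw [zero_sub, neg_div] at t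
  refine t.congr' ?_
  filter_upwards [self_mem_nhdsWithin] with ε hε
  rw [(Ff_full hs ha hb hε).2]
  have := gf_value hs ha hb hε
  rw [div_eq_iff hsin.ne']
  linear_combination -this

lemma cAlpha_eq {α : ℝ} (h0 : 0 < α) :
    cAlpha α = Real.sin (Real.pi * (α / 2)) / Real.pi := by
  have h := Real.Gamma_mul_Gamma_one_sub (α / 2)
  rw [cAlpha, add_comm 1, Real.Gamma_add_one (by positivity)]
  have : α / (2 * Real.Gamma (1 - α / 2) * (α / 2 * Real.Gamma (α / 2)))
    = 1 / (Real.Gamma (α / 2) * Real.Gamma (1 - α / 2)) := by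
    rw [show 2 * Real.Gamma (1 - α / 2) * (α / 2 * Real.Gamma (α / 2))
      = α * (Real.Gamma (α / 2) * Real.Gamma (1 - α / 2)) by ring, ← div_div, div_self h0.ne']
  rw [this, h, one_div_div]

lemma reduce {α r : ℝ} {d : ℕ} (v x : EuclideanSpace ℝ (Fin d)) (hx : ‖x‖ < r) (hv : v ≠ 0) :
    ∃ a b : ℝ, 0 < a ∧ 0 < b ∧ ∀ w : ℝ,
      (SFun α r (x + w • v) - SFun α r x) * |w| ^ (-1 - α)
        = (cAlpha α * ‖v‖ ^ α) * Ff (α / 2) a b w := by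
  have hn : 0 < ‖v‖ := norm_pos_iff.mpr hv
  set p := inner ℝ x v / ‖v‖ ^ 2 with hp
  have hpos : 0 < (r ^ 2 - ‖x‖ ^ 2) / ‖v‖ ^ 2 := by
    apply div_pos _ (by positivity)
    nlinarith [norm_nonneg x]
  set q := Real.sqrt (p ^ 2 + (r ^ 2 - ‖x‖ ^ 2) / ‖v‖ ^ 2) with hq
  have hq2 : q ^ 2 = p ^ 2 + (r ^ 2 - ‖x‖ ^ 2) / ‖v‖ ^ 2 := Real.sq_sqrt (by positivity)
  have hpq : |p| < q := by
    rw [hq]; apply Real.lt_sqrt_of_sq_lt; rw [sq_abs]; linarith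
  obtain ⟨h1, h2⟩ := abs_lt.mp hpq
  refine ⟨q + p, q - p, by linarith, by linarith, fun w => ?_⟩
  have hS : ∀ w : ℝ, SFun α r (x + w • v) =
      cAlpha α * ‖v‖ ^ α * (max ((q - p - w) * (q + p + w)) 0) ^ (α / 2) := by
    intro w
    have e : r ^ 2 - ‖x + w • v‖ ^ 2 = ‖v‖ ^ 2 * ((q - p - w) * (q + p + w)) := by
      rw [norm_add_sq_real, inner_smul_right, norm_smul, mul_pow, Real.norm_eq_abs, sq_abs]
      have e1 : inner ℝ x v = p * ‖v‖ ^ 2 := by rw [hp]; field_simp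
      have e2 : r ^ 2 - ‖x‖ ^ 2 = (q ^ 2 - p ^ 2) * ‖v‖ ^ 2 := by rw [hq2]; field_simp; ring
      rw [e1]
      linear_combination e2
    rw [SFun, e]
    have e3 : max (‖v‖ ^ 2 * ((q - p - w) * (q + p + w))) 0
        = ‖v‖ ^ 2 * max ((q - p - w) * (q + p + w)) 0 := by
      rw [mul_max_of_nonneg _ _ (by positivity), mul_zero]
    rw [e3, Real.mul_rpow (by positivity) (le_max_right _ _), ← Real.rpow_natCast, ← Real.rpow_mul hn.le,
      mul_assoc]
    congr 3
    push_cast; ring_nf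
  have hS0 : SFun α r x = cAlpha α * ‖v‖ ^ α * ((q + p) * (q - p)) ^ (α / 2) := by
    have := hS 0
    rw [zero_smul, add_zero, sub_zero, add_zero, max_eq_left (by nlinarith), mul_comm (q - p)] at this
    exact this
  rw [hS, hS0, Ff, show -1 - 2 * (α / 2) = -1 - α by ring]
  ring

end PVaux

/-- For every `v ∈ ℝ^d` and `|x| < r`, the principal-value integral
`K_v S_r(x) = p.v. ∫ (S_r(x + v w) - S_r(x)) |w|^{-1-α} dw` exists and
equals `-|v|^α`. -/
theorem pv_directional_SFun (α : ℝ) (hα0 : 0 < α) (hα2 : α < 2)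
    (d : ℕ) (hd : 1 ≤ d) (r : ℝ) (hr : 0 < r)
    (v x : EuclideanSpace ℝ (Fin d)) (hx : ‖x‖ < r) :
    (∀ ε > (0 : ℝ), IntegrableOn
        (fun w : ℝ => (SFun α r (x + w • v) - SFun α r x) * |w| ^ (-1 - α))
        {w : ℝ | ε < |w|}) ∧
    Tendsto (fun ε : ℝ => ∫ w in {w : ℝ | ε < |w|},
          (SFun α r (x + w • v) - SFun α r x) * |w| ^ (-1 - α))
        (𝓝[>] 0) (𝓝 (-‖v‖ ^ α)) := by
  by_cases hv : v = 0
  · subst hv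
    simp [Real.zero_rpow hα0.ne']
  · obtain ⟨a, b, ha, hb, h⟩ := PVaux.reduce (α := α) v x hx hv
    simp only [h]
    have hs : 0 < α / 2 := by linarith
    have hs1 : α / 2 < 1 := by linarith
    refine ⟨fun ε hε => (PVaux.Ff_full hs ha hb hε).1.const_mul _, ?_⟩
    have t := (PVaux.Ff_lim hs hs1 ha hb).const_mul (cAlpha α * ‖v‖ ^ α)
    simp only [integral_const_mul]
    convert t using 2
    rw [PVaux.cAlpha_eq hα0]
    have hpi := Real.pi_pos
    have hsin : 0 < Real.sin (Real.pi * (α / 2)) :=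
      Real.sin_pos_of_pos_of_lt_pi (by positivity) (by nlinarith)
    generalize Real.sin (Real.pi * (α / 2)) = S at hsin
    field_simp
end

section
/- Let 0 < α < 2, d ≥ 1, r > 0, let c_α = α/(2·Γ(1−α/2)·Γ(1+α/2)), and define S_r : ℝ^d → ℝ by S_r(x) = c_α·((r² − |x|²)⁺)^{α/2}. Let μ be a finite (nonnegative) measure on the unit sphere 𝒮 = {z ∈ ℝ^d : |z| = 1}, and let A : ℝ^d → (ℝ^d →ₗ ℝ^d) assign to each x a linear map (d×d matrix) A(x). Then for every x ∈ ℝ^d with |x| < r, the iterated principal-value integral 𝒦 S_r(x) := ∫_𝒮 [ lim_{ε→0⁺} ∫_{|w|>ε} (S_r(x + A(x)z·w) − S_r(x))·|w|^{−1−α} dw ] μ(dz) is well defined and equals −∫_𝒮 |A(x)z|^α μ(dz). -/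
open MeasureTheory Topology Filter Set

lemma aux_beta (β : ℝ) (h0 : 0 < β) (h1 : β < 1) :
    IntegrableOn (fun v : ℝ => v ^ (β - 1) / (1 + v)) (Ioi 0) ∧
    ∫ v in Ioi (0:ℝ), v ^ (β - 1) / (1 + v) = Real.Gamma β * Real.Gamma (1 - β) := by
  have himg : (fun v : ℝ => v / (1 + v)) '' Ioi 0 = Ioo 0 1 := by
    ext y
    constructor
    · rintro ⟨v, hv, rfl⟩
      have hv' : (0:ℝ) < v := hv
      refine ⟨by positivity, ?_⟩
      change v / (1 + v) < 1
      rw [div_lt_one (by positivity)]; linarith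
    · rintro ⟨hy0, hy1⟩
      refine ⟨y / (1 - y), div_pos hy0 (by linarith), ?_⟩
      have : 1 - y ≠ 0 := by linarith
      change y / (1 - y) / (1 + y / (1 - y)) = y
      field_simp
      ring
  have hder : ∀ v ∈ Ioi (0:ℝ), HasDerivWithinAt (fun v : ℝ => v / (1 + v)) (1 / (1 + v) ^ 2) (Ioi 0) v := by
    intro v hv
    have hv' : (0:ℝ) < v := hv
    have := (hasDerivAt_id v).div ((hasDerivAt_id v).const_add 1) (by simp; positivity)
    refine HasDerivAt.hasDerivWithinAt ?_
    refine this.congr_deriv ?_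
    simp
  have hinj : InjOn (fun v : ℝ => v / (1 + v)) (Ioi 0) := by
    intro a ha b hb hab
    have ha' : (0:ℝ) < a := ha
    have hb' : (0:ℝ) < b := hb
    change a / (1 + a) = b / (1 + b) at hab
    rw [div_eq_div_iff (by positivity) (by positivity)] at hab
    linarith
  have hcongr : EqOn (fun v : ℝ => |1 / (1 + v) ^ 2| • ((fun x : ℝ => x ^ (β - 1) * (1 - x) ^ (-β)) (v / (1 + v))))
      (fun v : ℝ => v ^ (β - 1) / (1 + v)) (Ioi 0) := by
    intro v hv
    have hv' : (0:ℝ) < v := hv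
    have e1 : 1 - v / (1 + v) = (1 + v)⁻¹ := by field_simp; ring
    have hp : (0:ℝ) < 1 + v := by positivity
    simp only [smul_eq_mul]
    rw [e1, abs_of_pos (by positivity), Real.div_rpow hv'.le hp.le, Real.inv_rpow hp.le,
      Real.rpow_neg hp.le, inv_inv, Real.rpow_sub_one hp.ne']
    have : (1 + v) ^ β ≠ 0 := (Real.rpow_pos_of_pos hp _).ne'
    field_simp
  have hI : IntervalIntegrable (fun x : ℝ => x ^ (β - 1) * (1 - x) ^ (-β)) volume 0 1 ∧
     ∫ x in (0:ℝ)..1, x ^ (β - 1) * (1 - x) ^ (-β) = Real.Gamma β * Real.Gamma (1 - β) := by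
    have hc := Complex.betaIntegral_convergent (u := (β:ℂ)) (v := ((1 - β : ℝ) : ℂ)) (by simpa) (by simp; exact h1)
    have hE := Complex.Gamma_mul_Gamma_eq_betaIntegral (s := (β:ℂ)) (t := ((1 - β : ℝ) : ℂ)) (by simpa) (by simp; exact h1)
    have hcg : ∀ x ∈ uIcc (0:ℝ) 1, ((x : ℂ) ^ ((β:ℂ) - 1) * (1 - (x : ℂ)) ^ (((1 - β : ℝ) : ℂ) - 1)) =
       ((x ^ (β - 1) * (1 - x) ^ (-β) : ℝ) : ℂ) := by
      intro x hx
      rw [uIcc_of_le zero_le_one] at hx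
      push_cast
      rw [Complex.ofReal_cpow hx.1, Complex.ofReal_cpow (by linarith [hx.2])]
      push_cast
      congr 2
      ring
    have hc2 : IntervalIntegrable (fun x : ℝ => ((x ^ (β - 1) * (1 - x) ^ (-β) : ℝ) : ℂ)) volume 0 1 := by
      refine hc.congr ?_
      intro x hx
      exact hcg x (uIoc_subset_uIcc hx)
    refine ⟨?_, ?_⟩
    · rw [intervalIntegrable_iff] at hc2 ⊢
      have := hc2.re
      simpa [IntegrableOn] using this
    · rw [Complex.betaIntegral, intervalIntegral.integral_congr hcg, intervalIntegral.integral_ofReal,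
        Complex.Gamma_ofReal, Complex.Gamma_ofReal] at hE
      have : (β:ℂ) + ((1 - β : ℝ) : ℂ) = 1 := by push_cast; ring
      rw [this, Complex.Gamma_one, one_mul] at hE
      exact_mod_cast hE.symm
  rw [intervalIntegrable_iff_integrableOn_Ioo_of_le zero_le_one, intervalIntegral.integral_of_le zero_le_one,
    integral_Ioc_eq_integral_Ioo, ← himg] at hI
  refine ⟨?_, ?_⟩
  · have := (integrableOn_image_iff_integrableOn_abs_deriv_smul measurableSet_Ioi hder hinj _).1 hI.1
    exact (integrableOn_congr_fun hcongr measurableSet_Ioi).1 this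
  · rw [← hI.2, integral_image_eq_integral_abs_deriv_smul measurableSet_Ioi hder hinj]
    exact (setIntegral_congr_fun measurableSet_Ioi hcongr).symm

/-- derivative tending to zero implies shift differences tend to zero -/
lemma aux_shift (f f' : ℝ → ℝ) (a : ℝ) (hf : ∀ᶠ x in atTop, HasDerivAt f (f' x) x)
    (hf' : Tendsto f' atTop (𝓝 0)) :
    Tendsto (fun x => f (x + a) - f x) atTop (𝓝 0) := by
  rw [Metric.tendsto_atTop]
  intro e he
  have h2 := (Metric.tendsto_atTop.1 hf') (e / (|a| + 1)) (by positivity)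
  obtain ⟨N1, hN1⟩ := h2
  obtain ⟨N2, hN2⟩ := eventually_atTop.1 hf
  refine ⟨max N1 N2 + |a|, fun x hx => ?_⟩
  have key := Convex.norm_image_sub_le_of_norm_hasDerivWithin_le (f := f) (f' := f')
    (s := Ici (max N1 N2)) (x := x) (y := x + a) (C := e / (|a| + 1))
    (fun y hy => (hN2 y (le_trans (le_max_right _ _) hy)).hasDerivWithinAt)
    (fun y hy => by
      have := hN1 y (le_trans (le_max_left _ _) hy)
      simpa [dist_eq_norm] using this.le) (convex_Ici _)
    (by simp only [mem_Ici]; linarith [abs_nonneg a]) (by simp only [mem_Ici]; linarith [neg_abs_le a])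
  rw [dist_zero_right]
  refine lt_of_le_of_lt key ?_
  rw [add_sub_cancel_left, Real.norm_eq_abs, div_mul_eq_mul_div, div_lt_iff₀ (by positivity)]
  nlinarith [abs_nonneg a]

lemma aux_K (β : ℝ) (h0 : 0 < β) (h1 : β < 1) :
    Tendsto (fun V : ℝ => (∫ v in (0:ℝ)..V, v ^ β / (1 + v)) - V ^ β / β) atTop
      (𝓝 (-(Real.Gamma β * Real.Gamma (1 - β)))) := by
  obtain ⟨hi, he⟩ := aux_beta β h0 h1
  have ht := (intervalIntegral_tendsto_integral_Ioi 0 hi tendsto_id).neg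
  rw [he] at ht
  refine ht.congr' ?_
  filter_upwards [eventually_gt_atTop 0] with V hV
  have i1 : IntervalIntegrable (fun v : ℝ => v ^ (β - 1)) volume 0 V :=
    intervalIntegral.intervalIntegrable_rpow' (by linarith)
  have i2 : IntervalIntegrable (fun v : ℝ => v ^ (β - 1) / (1 + v)) volume 0 V := by
    rw [intervalIntegrable_iff_integrableOn_Ioc_of_le hV.le]
    exact hi.mono_set Ioc_subset_Ioi_self
  have e1 : ∫ v in (0:ℝ)..V, v ^ (β - 1) = V ^ β / β := by
    rw [integral_rpow (Or.inl (by linarith))]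
    simp [Real.zero_rpow h0.ne']
  rw [← e1]
  simp only [id]
  rw [neg_eq_iff_add_eq_zero, add_sub, sub_eq_zero, ← e1.trans e1.symm]
  have e2 : ∫ v in (0:ℝ)..V, v ^ β / (1 + v) = ∫ v in (0:ℝ)..V, (v ^ (β - 1) - v ^ (β - 1) / (1 + v)) := by
    apply intervalIntegral.integral_congr_ae
    refine Eventually.of_forall fun v hv => ?_
    rw [uIoc_of_le hV.le] at hv
    have hv0 := hv.1
    rw [Real.rpow_sub_one hv0.ne']
    field_simp
    ring
  rw [e2, intervalIntegral.integral_sub i1 i2]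
  ring

/-- the one-sided integral in the inverted variable -/
noncomputable def auxG (β D c M : ℝ) : ℝ := ∫ s in D..M, (s ^ 2 - D ^ 2) ^ β / (s + c)

lemma aux_contOn (β D c : ℝ) (h0 : 0 < β) (hDc : 0 < D + c) :
    ContinuousOn (fun s : ℝ => (s ^ 2 - D ^ 2) ^ β / (s + c)) (Ici D) := by
  apply ContinuousOn.div
  · apply ContinuousOn.rpow_const (by fun_prop)
    intro x hx
    exact Or.inr h0.le
  · fun_prop
  · intro x hx
    have : D ≤ x := hx
    linarith

lemma aux_Eshift (β D c a : ℝ) (h0 : 0 < β) (h1 : β < 1) (hD : 0 < D) (hDD : D ^ 2 = 1 + c ^ 2)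
    (hDc : 0 < D + c) :
    Tendsto (fun N : ℝ => (auxG β D c (N + a) - ((N + a) ^ 2 - D ^ 2) ^ β / (2 * β)) -
      (auxG β D c N - (N ^ 2 - D ^ 2) ^ β / (2 * β))) atTop (𝓝 0) := by
  have hcont := aux_contOn β D c h0 hDc
  refine aux_shift (fun M => auxG β D c M - (M ^ 2 - D ^ 2) ^ β / (2 * β))
    (fun M => (M ^ 2 - D ^ 2) ^ (β - 1) * (-(c + 1 / (M + c)))) a ?_ ?_
  · filter_upwards [eventually_gt_atTop D] with M hM
    have hpos : 0 < M ^ 2 - D ^ 2 := by nlinarith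
    have d1 : HasDerivAt (auxG β D c) ((M ^ 2 - D ^ 2) ^ β / (M + c)) M := by
      apply intervalIntegral.integral_hasDerivAt_right
      · apply ContinuousOn.intervalIntegrable
        apply hcont.mono
        rw [uIcc_of_le hM.le]
        exact Icc_subset_Ici_self
      · exact ContinuousOn.stronglyMeasurableAtFilter isOpen_Ioi (hcont.mono Ioi_subset_Ici_self) M hM
      · exact hcont.continuousAt (Ici_mem_nhds hM)
    have d2 : HasDerivAt (fun M : ℝ => (M ^ 2 - D ^ 2) ^ β / (2 * β)) 
        ((2 * M) * β * (M ^ 2 - D ^ 2) ^ (β - 1) / (2 * β)) M := by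
      have : HasDerivAt (fun M : ℝ => M ^ 2 - D ^ 2) (2 * M) M := by
        simpa using (hasDerivAt_pow 2 M).sub_const (D ^ 2)
      exact (this.rpow_const (Or.inl hpos.ne')).div_const _
    refine (d1.sub d2).congr_deriv ?_
    have hMc : M + c ≠ 0 := by linarith
    rw [Real.rpow_sub_one hpos.ne']
    field_simp
    have : D ^ 2 = 1 + c ^ 2 := hDD
    rw [this]; ring
  · have t1 : Tendsto (fun M : ℝ => M ^ 2 - D ^ 2) atTop atTop :=
      tendsto_atTop_add_const_right _ _ (tendsto_pow_atTop two_ne_zero)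
    have t2 : Tendsto (fun M : ℝ => (M ^ 2 - D ^ 2) ^ (β - 1)) atTop (𝓝 0) := by
      have := (tendsto_rpow_neg_atTop (y := 1 - β) (by linarith)).comp t1
      simpa [Function.comp_def] using this
    have t3 : Tendsto (fun M : ℝ => 1 / (M + c)) atTop (𝓝 0) :=
      (tendsto_const_nhds).div_atTop (tendsto_atTop_add_const_right _ _ tendsto_id)
    simpa using t2.mul (t3.const_add c).neg

lemma aux_Gsum (β D c M : ℝ) (h0 : 0 < β) (hD : 0 < D) (hDD : D ^ 2 = 1 + c ^ 2)
    (hDc : 0 < D + c) (hDc' : 0 < D + -c) (hM : D ≤ M) :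
    auxG β D c M + auxG β D (-c) M = ∫ v in (0:ℝ)..(M ^ 2 - D ^ 2), v ^ β / (1 + v) := by
  have hii : ∀ c, 0 < D + c → IntervalIntegrable (fun s : ℝ => (s ^ 2 - D ^ 2) ^ β / (s + c)) volume D M := by
    intro c hc
    apply ContinuousOn.intervalIntegrable
    apply (aux_contOn β D c h0 hc).mono
    rw [uIcc_of_le hM]
    exact Icc_subset_Ici_self
  rw [auxG, auxG, ← intervalIntegral.integral_add (hii c hDc) (hii (-c) hDc')]
  have hs := intervalIntegral.integral_comp_mul_deriv' (a := D) (b := M) (f := fun s : ℝ => s ^ 2 - D ^ 2)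
    (f' := fun s => 2 * s) (g := fun v : ℝ => v ^ β / (1 + v))
    (fun s _ => by simpa using (hasDerivAt_pow 2 s).sub_const (D ^ 2)) (by fun_prop)
    (by
      apply ContinuousOn.div
      · exact (Real.continuous_rpow_const h0.le).continuousOn
      · fun_prop
      · rintro _ ⟨s, hs, rfl⟩
        rw [uIcc_of_le hM] at hs
        have := hs.1
        change 1 + (s ^ 2 - D ^ 2) ≠ 0
        nlinarith)
  simp only [sub_self] at hs
  rw [← hs]
  apply intervalIntegral.integral_congr
  intro s hs
  rw [uIcc_of_le hM] at hs
  have h1 : s + c ≠ 0 := by linarith [hs.1]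
  have h2 : s + -c ≠ 0 := by linarith [hs.1]
  have h3 : 1 + (s ^ 2 - D ^ 2) = (s + c) * (s + -c) := by rw [hDD]; ring
  simp only [Function.comp]
  rw [h3]
  field_simp
  ring

lemma aux_second (p c : ℝ) (h1 : p < 2) :
    Tendsto (fun N : ℝ => (N + c) ^ p + (N - c) ^ p - 2 * N ^ p) atTop (𝓝 0) := by
  have hd : ∀ q : ℝ, ∀ x : ℝ, 0 < x → HasDerivAt (fun y : ℝ => y ^ q) (q * x ^ (q - 1)) x := by
    intro q x hx
    exact Real.hasDerivAt_rpow_const (Or.inl hx.ne')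
  have s1 : Tendsto (fun x : ℝ => (x + c) ^ (p - 1) - x ^ (p - 1)) atTop (𝓝 0) := by
    refine aux_shift (fun x : ℝ => x ^ (p - 1)) (fun x => (p - 1) * x ^ (p - 1 - 1)) c ?_ ?_
    · filter_upwards [eventually_gt_atTop 0] with x hx using hd _ x hx
    · have := (tendsto_rpow_neg_atTop (y := 2 - p) (by linarith)).const_mul (p - 1)
      convert this using 2
      · congr 2; ring
      · simp
  have s2 := aux_shift (fun x : ℝ => (x + c) ^ p - x ^ p)
    (fun x => p * ((x + c) ^ (p - 1) - x ^ (p - 1))) (-c) (by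
      filter_upwards [eventually_gt_atTop 0, eventually_gt_atTop (-c)] with x hx hx2
      have a1 := (hd p (x + c) (by linarith)).comp_add_const x c
      refine (a1.sub (hd p x hx)).congr_deriv ?_
      ring) (by simpa using s1.const_mul p)
  have s3 := s2.neg
  rw [neg_zero] at s3
  refine s3.congr fun x => ?_
  simp only [← sub_eq_add_neg, sub_add_cancel]
  ring

lemma aux_main_s4 (β D c : ℝ) (h0 : 0 < β) (h1 : β < 1) (hD : 0 < D) (hDD : D ^ 2 = 1 + c ^ 2)
    (hDc : 0 < D + c) (hDc' : 0 < D + -c) :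
    Tendsto (fun N : ℝ => auxG β D c (N - c) + auxG β D (-c) (N + c) - N ^ (2 * β) / β) atTop
      (𝓝 (-(Real.Gamma β * Real.Gamma (1 - β)))) := by
  have e1 := aux_Eshift β D c (-c) h0 h1 hD hDD hDc
  have e2 := aux_Eshift β D (-c) c h0 h1 hD (by rw [hDD]; ring) hDc'
  have t1 : Tendsto (fun M : ℝ => M ^ 2 - D ^ 2) atTop atTop :=
    tendsto_atTop_add_const_right _ _ (tendsto_pow_atTop two_ne_zero)
  have k := (aux_K β h0 h1).comp t1
  have g1 : Tendsto (fun x : ℝ => (x + -D ^ 2) ^ β - x ^ β) atTop (𝓝 0) := by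
    refine aux_shift (fun x : ℝ => x ^ β) (fun x => β * x ^ (β - 1)) _ ?_ ?_
    · filter_upwards [eventually_gt_atTop 0] with x hx
      exact Real.hasDerivAt_rpow_const (Or.inl hx.ne')
    · have := (tendsto_rpow_neg_atTop (y := 1 - β) (by linarith)).const_mul β
      simpa using this
  have g2 : ∀ a : ℝ, Tendsto (fun N : ℝ => (N + a) ^ 2) atTop atTop := fun a =>
    (tendsto_pow_atTop two_ne_zero).comp (tendsto_atTop_add_const_right _ _ tendsto_id)
  have g3 := g1.comp (g2 c)
  have g4 := g1.comp (g2 (-c))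
  have sd := aux_second (2 * β) c (by linarith)
  have tot := ((e1.add e2).add k).add (((g3.add g4).add sd).div_const (2 * β))
  simp only [add_zero, zero_add, zero_div] at tot
  refine tot.congr' ?_
  filter_upwards [eventually_ge_atTop D, eventually_gt_atTop (|c|)] with N hN hNc
  have p1 : ((N + c) ^ 2) ^ β = (N + c) ^ (2 * β) := by
    rw [Real.rpow_mul (by linarith [neg_abs_le c])]; norm_cast
  have p2 : ((N + -c) ^ 2) ^ β = (N - c) ^ (2 * β) := by
    rw [← sub_eq_add_neg, Real.rpow_mul (by linarith [le_abs_self c])]; norm_cast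
  simp only [Function.comp]
  rw [← aux_Gsum β D c N h0 hD hDD hDc hDc' hN, p1, p2]
  simp only [← sub_eq_add_neg]
  field_simp
  ring

lemma aux_half (β D c ε : ℝ) (h0 : 0 < β) (hD : 0 < D) (hDD : D ^ 2 = 1 + c ^ 2)
    (hDc : 0 < D + c) (hDc' : 0 < D + -c) (he : 0 < ε) (he2 : ε < D - c) :
    IntegrableOn (fun y : ℝ => ((max (1 - 2 * c * y - y ^ 2) 0) ^ β - 1) * |y| ^ (-1 - 2 * β)) (Ioi ε) ∧
    ∫ y in Ioi ε, ((max (1 - 2 * c * y - y ^ 2) 0) ^ β - 1) * |y| ^ (-1 - 2 * β) =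
      auxG β D c (1 / ε - c) - (1 / ε) ^ (2 * β) / (2 * β) := by
  set φ : ℝ → ℝ := fun y => (max (1 - 2 * c * y - y ^ 2) 0) ^ β * y ^ (-1 - 2 * β) with hφ
  have hφc : ContinuousOn φ (Ioi 0) := by
    apply ContinuousOn.mul
    · apply ContinuousOn.rpow_const (by fun_prop)
      intro x hx; exact Or.inr h0.le
    · apply ContinuousOn.rpow_const (by fun_prop)
      intro x hx; exact Or.inl (ne_of_gt hx)
  have hφ0 : ∀ y, D - c ≤ y → φ y = 0 := by
    intro y hy
    have : 1 - 2 * c * y - y ^ 2 ≤ 0 := by nlinarith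
    simp only [hφ]
    rw [max_eq_right this, Real.zero_rpow h0.ne', zero_mul]
  have hpi := integrableOn_Ioi_rpow_of_lt (a := -1 - 2 * β) (by linarith) he
  have hpe := integral_Ioi_rpow_of_lt (a := -1 - 2 * β) (by linarith) he
  have hφ1 : IntegrableOn φ (Ioc ε (D - c)) := by
    rw [← intervalIntegrable_iff_integrableOn_Ioc_of_le he2.le]
    apply ContinuousOn.intervalIntegrable
    apply hφc.mono
    rw [uIcc_of_le he2.le]
    intro y hy; exact lt_of_lt_of_le he hy.1
  have hφ2 : IntegrableOn φ (Ioi (D - c)) := by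
    refine (integrableOn_congr_fun (g := fun _ => (0:ℝ)) ?_ measurableSet_Ioi).2 integrableOn_zero
    intro y hy; exact hφ0 y (le_of_lt hy)
  have hun : Ioi ε = Ioc ε (D - c) ∪ Ioi (D - c) := (Ioc_union_Ioi_eq_Ioi he2.le).symm
  have hφi : IntegrableOn φ (Ioi ε) := by
    rw [hun]; exact hφ1.union hφ2
  have hcg : EqOn (fun y : ℝ => ((max (1 - 2 * c * y - y ^ 2) 0) ^ β - 1) * |y| ^ (-1 - 2 * β))
      (fun y => φ y - y ^ (-1 - 2 * β)) (Ioi ε) := by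
    intro y hy
    have : 0 < y := lt_trans he hy
    simp only [hφ]
    rw [abs_of_pos this]
    ring
  refine ⟨(integrableOn_congr_fun hcg measurableSet_Ioi).2 (hφi.sub hpi), ?_⟩
  rw [setIntegral_congr_fun measurableSet_Ioi hcg, integral_sub hφi hpi, hpe]
  have e1 : ∫ y in Ioi ε, φ y = auxG β D c (1 / ε - c) := by
    rw [hun, setIntegral_union (Ioc_disjoint_Ioi le_rfl) measurableSet_Ioi hφ1 hφ2,
      setIntegral_congr_fun (g := fun _ => (0:ℝ)) measurableSet_Ioi (fun y hy => hφ0 y (le_of_lt hy)),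
      integral_zero, add_zero, ← intervalIntegral.integral_of_le he2.le]
    have hM : D ≤ 1 / ε - c := by
      rw [le_sub_iff_add_le, le_div_iff₀ he]
      nlinarith
    have hs := intervalIntegral.integral_comp_mul_deriv' (a := D) (b := 1 / ε - c)
      (f := fun s : ℝ => (s + c)⁻¹) (f' := fun s => -(1 / (s + c) ^ 2)) (g := φ)
      (fun s hs => by
        rw [uIcc_of_le hM] at hs
        have hsc : s + c ≠ 0 := by linarith [hs.1]
        have := ((hasDerivAt_id s).add_const c).inv hsc
        refine this.congr_deriv ?_
        simp [neg_div])
      (by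
        rw [uIcc_of_le hM]
        apply ContinuousOn.neg
        apply ContinuousOn.div (by fun_prop) (by fun_prop)
        intro s hs
        have hsc : 0 < s + c := by linarith [hs.1]
        positivity)
      (by
        apply hφc.mono
        rintro _ ⟨s, hs, rfl⟩
        rw [uIcc_of_le hM] at hs
        have hsc : 0 < s + c := by linarith [hs.1]
        exact inv_pos.2 hsc)
    have q1 : (D + c)⁻¹ = D - c := by
      rw [inv_eq_iff_eq_inv, eq_comm, inv_eq_iff_eq_inv]
      field_simp; nlinarith
    have q2 : (1 / ε - c + c)⁻¹ = ε := by simp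
    simp only [q1, q2] at hs
    rw [intervalIntegral.integral_symm, ← hs, ← intervalIntegral.integral_neg, auxG]
    apply intervalIntegral.integral_congr
    intro s hs
    rw [uIcc_of_le hM] at hs
    have hsc : 0 < s + c := by linarith [hs.1]
    have hsD : 0 ≤ s ^ 2 - D ^ 2 := by nlinarith [hs.1]
    have a1 : 1 - 2 * c * (s + c)⁻¹ - (s + c)⁻¹ ^ 2 = (s ^ 2 - D ^ 2) * ((s + c) ^ 2)⁻¹ := by
      rw [hDD]; field_simp; ring
    simp only [Function.comp, hφ]
    rw [a1, max_eq_left (by positivity), Real.mul_rpow hsD (by positivity), Real.inv_rpow (by positivity),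
      Real.inv_rpow hsc.le, ← Real.rpow_neg hsc.le, ← Real.rpow_natCast (s + c) 2, ← Real.rpow_mul hsc.le,
      ← Real.rpow_neg hsc.le]
    have a2 : (s + c) ^ (-((2:ℕ) * β)) * (s + c) ^ (-(-1 - 2 * β)) = s + c := by
      rw [← Real.rpow_add hsc]
      convert Real.rpow_one (s + c) using 2
      push_cast; ring
    have a3 : (s + c) ^ ((2:ℕ) : ℝ) = (s + c) ^ 2 := by norm_cast
    rw [mul_assoc ((s ^ 2 - D ^ 2) ^ β), a2, a3]
    field_simp
  rw [e1]
  congr 1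
  have : -1 - 2 * β + 1 = -(2 * β) := by ring
  rw [this, one_div, Real.inv_rpow he.le, Real.rpow_neg he.le]
  field_simp

lemma aux_oneD (β c : ℝ) (h0 : 0 < β) (h1 : β < 1) :
    Tendsto (fun ε : ℝ => ∫ y in {y : ℝ | ε < |y|},
      ((max (1 - 2 * c * y - y ^ 2) 0) ^ β - 1) * |y| ^ (-1 - 2 * β)) (𝓝[>] 0)
      (𝓝 (-(Real.Gamma β * Real.Gamma (1 - β)))) := by
  obtain ⟨D, hD, hDD⟩ : ∃ D : ℝ, 0 < D ∧ D ^ 2 = 1 + c ^ 2 :=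
    ⟨√(1 + c ^ 2), by positivity, Real.sq_sqrt (by positivity)⟩
  have hDc : 0 < D + c := by
    by_contra h
    nlinarith
  have hDc' : 0 < D + -c := by
    by_contra h
    nlinarith
  have hm := (aux_main_s4 β D c h0 h1 hD hDD hDc hDc').comp tendsto_inv_nhdsGT_zero
  refine hm.congr' ?_
  have m1 : Ioo 0 (min (D - c) (D + c)) ∈ 𝓝[>] (0:ℝ) :=
    Ioo_mem_nhdsGT (lt_min (by linarith) hDc)
  filter_upwards [m1] with ε hε
  have he := hε.1
  obtain ⟨a1, a2⟩ := aux_half β D c ε h0 hD hDD hDc hDc' he (lt_of_lt_of_le hε.2 (min_le_left _ _))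
  obtain ⟨b1, b2⟩ := aux_half β D (-c) ε h0 hD (by rw [hDD]; ring) hDc' (by linarith) he
    (by linarith [lt_of_lt_of_le hε.2 (min_le_right _ _)])
  set F : ℝ → ℝ := fun y => ((max (1 - 2 * c * y - y ^ 2) 0) ^ β - 1) * |y| ^ (-1 - 2 * β) with hF
  have hFn : (fun y : ℝ => ((max (1 - 2 * (-c) * y - y ^ 2) 0) ^ β - 1) * |y| ^ (-1 - 2 * β)) = fun y => F (-y) := by
    funext y
    simp only [hF, abs_neg]
    congr 4
    ring_nf
  rw [hFn] at b1 b2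
  have hset : {y : ℝ | ε < |y|} = Iio (-ε) ∪ Ioi ε := by
    ext y
    simp only [mem_ofPred_eq, mem_union, mem_Iio, mem_Ioi, lt_abs]
    constructor
    · rintro (h | h)
      · right; exact h
      · left; linarith
    · rintro (h | h)
      · right; linarith
      · left; exact h
  have c1 : IntegrableOn F (Iio (-ε)) := by
    have := b1.comp_neg
    simpa using this
  have c2 : ∫ y in Iio (-ε), F y = ∫ y in Ioi ε, F (-y) := by
    rw [integral_comp_neg_Ioi, integral_Iic_eq_integral_Iio]
  rw [hset, setIntegral_union _ measurableSet_Ioi c1 a1, c2, a2, b2]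
  · simp only [Function.comp, one_div, sub_neg_eq_add]
    field_simp
    ring
  · rw [Set.disjoint_left]
    intro y h1 h2
    simp only [mem_Iio, mem_Ioi] at h1 h2
    linarith

lemma aux_const (α : ℝ) (hα0 : 0 < α) (hα2 : α < 2) :
    cAlpha α * (Real.Gamma (α / 2) * Real.Gamma (1 - α / 2)) = 1 := by
  have g1 : 0 < Real.Gamma (α / 2) := Real.Gamma_pos_of_pos (by linarith)
  have g2 : 0 < Real.Gamma (1 - α / 2) := Real.Gamma_pos_of_pos (by linarith)
  rw [cAlpha, add_comm 1 (α / 2), Real.Gamma_add_one (by linarith)]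
  generalize Real.Gamma (1 - α / 2) = a at *
  generalize Real.Gamma (α / 2) = b at *
  field_simp

lemma aux_vec (α : ℝ) (hα0 : 0 < α) (hα2 : α < 2) (d : ℕ) (r : ℝ) 
    (x v : EuclideanSpace ℝ (Fin d)) (hx : ‖x‖ < r) :
    Tendsto (fun ε : ℝ => ∫ w in {w : ℝ | ε < |w|},
            (SFun α r (x + w • v) - SFun α r x) * |w| ^ (-1 - α))
          (𝓝[>] 0) (𝓝 (-‖v‖ ^ α)) := by
  by_cases hv : v = 0
  · subst hv
    simp [Real.zero_rpow hα0.ne']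
  have hv0 : 0 < ‖v‖ := norm_pos_iff.2 hv
  have hq : 0 < r ^ 2 - ‖x‖ ^ 2 := by nlinarith [norm_nonneg x]
  obtain ⟨k, hk, hkk⟩ : ∃ k : ℝ, 0 < k ∧ k ^ 2 = r ^ 2 - ‖x‖ ^ 2 :=
    ⟨√(r ^ 2 - ‖x‖ ^ 2), by positivity, Real.sq_sqrt hq.le⟩
  set l : ℝ := k / ‖v‖ with hl
  have hl0 : 0 < l := by positivity
  set c : ℝ := inner ℝ x v / (k * ‖v‖) with hc
  have key : ∀ y : ℝ, (SFun α r (x + (l * y) • v) - SFun α r x) * |l * y| ^ (-1 - α) =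
      cAlpha α * ‖v‖ ^ α * l⁻¹ *
       (((max (1 - 2 * c * y - y ^ 2) 0) ^ (α / 2) - 1) * |y| ^ (-1 - 2 * (α / 2))) := by
    intro y
    have n1 : r ^ 2 - ‖x + (l * y) • v‖ ^ 2 = k ^ 2 * (1 - 2 * c * y - y ^ 2) := by
      rw [norm_add_sq_real, norm_smul, inner_smul_right, mul_pow, Real.norm_eq_abs, sq_abs, hl, hc]
      have : r ^ 2 = k ^ 2 + ‖x‖ ^ 2 := by rw [hkk]; ring
      rw [this]
      field_simp
      ring
    have n2 : max (k ^ 2 * (1 - 2 * c * y - y ^ 2)) 0 = k ^ 2 * max (1 - 2 * c * y - y ^ 2) 0 := by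
      rw [mul_max_of_nonneg _ _ (by positivity), mul_zero]
    have n3 : (k ^ 2) ^ (α / 2) = k ^ α := by
      rw [← Real.rpow_natCast, ← Real.rpow_mul hk.le]; congr 1; push_cast; ring
    have n4 : (-1 - 2 * (α / 2)) = -1 - α := by ring
    rw [SFun, SFun, n1, n2, ← hkk, max_eq_left (sq_nonneg k), Real.mul_rpow (by positivity) (le_max_right _ _),
      n3, abs_mul, abs_of_pos hl0, Real.mul_rpow hl0.le (abs_nonneg _), n4]
    have n5 : k ^ α * l ^ (-1 - α) = ‖v‖ ^ α * l⁻¹ := by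
      have : k = l * ‖v‖ := by rw [hl]; field_simp
      rw [this, Real.mul_rpow hl0.le hv0.le, Real.rpow_sub hl0, Real.rpow_neg_one]
      have : l ^ α ≠ 0 := (Real.rpow_pos_of_pos hl0 _).ne'
      field_simp
    linear_combination cAlpha α * ((max (1 - 2 * c * y - y ^ 2) 0) ^ (α / 2) - 1) * |y| ^ (-1 - α) * n5
  have scale : ∀ ε : ℝ, ∫ w in {w : ℝ | ε < |w|},
            (SFun α r (x + w • v) - SFun α r x) * |w| ^ (-1 - α) =
      cAlpha α * ‖v‖ ^ α * ∫ y in {y : ℝ | ε / l < |y|},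
       ((max (1 - 2 * c * y - y ^ 2) 0) ^ (α / 2) - 1) * |y| ^ (-1 - 2 * (α / 2)) := by
    intro ε
    have ms : ∀ ε : ℝ, MeasurableSet {w : ℝ | ε < |w|} := fun ε =>
      measurableSet_lt measurable_const measurable_norm
    rw [← integral_indicator (ms _), ← integral_indicator (ms _)]
    have := Measure.integral_comp_mul_left (Set.indicator {w : ℝ | ε < |w|} (fun w : ℝ =>
            (SFun α r (x + w • v) - SFun α r x) * |w| ^ (-1 - α))) l
    rw [abs_of_pos (inv_pos.2 hl0), smul_eq_mul] at this
    rw [← mul_left_cancel_iff_of_pos (inv_pos.2 hl0), ← this, ← mul_assoc, ← integral_const_mul]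
    congr 1
    funext y
    have hiff : ε < |l * y| ↔ ε / l < |y| := by
      rw [abs_mul, abs_of_pos hl0, div_lt_iff₀' hl0]
    by_cases h : ε / l < |y|
    · rw [indicator_of_mem (show l * y ∈ {w : ℝ | ε < |w|} from hiff.2 h),
        indicator_of_mem (show y ∈ {w : ℝ | ε / l < |w|} from h), key]
      ring
    · rw [indicator_of_notMem (show l * y ∉ {w : ℝ | ε < |w|} from fun h' => h (hiff.1 h')),
        indicator_of_notMem (show y ∉ {w : ℝ | ε / l < |w|} from h), mul_zero]
  simp_rw [scale]
  have hs : Tendsto (fun ε : ℝ => ε / l) (𝓝[>] 0) (𝓝[>] 0) := by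
    refine tendsto_nhdsWithin_iff.2 ⟨?_, ?_⟩
    · have : Tendsto (fun ε : ℝ => ε / l) (𝓝 0) (𝓝 (0 / l)) := tendsto_id.div_const l
      rw [zero_div] at this
      exact this.mono_left nhdsWithin_le_nhds
    · filter_upwards [self_mem_nhdsWithin] with ε hε
      exact div_pos hε hl0
  have fin := ((aux_oneD (α / 2) c (by linarith) (by linarith)).comp hs).const_mul (cAlpha α * ‖v‖ ^ α)
  have e : cAlpha α * ‖v‖ ^ α * -(Real.Gamma (α / 2) * Real.Gamma (1 - α / 2)) = -‖v‖ ^ α := by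
    linear_combination (-‖v‖ ^ α) * aux_const α hα0 hα2
  rw [e] at fin
  exact fin

/-- For a finite measure `μ` on the unit sphere and a family of matrices `A(x)`,
the iterated principal-value integral
`𝒦 S_r(x) = ∫_𝒮 [p.v. ∫ (S_r(x + A(x)z w) - S_r(x)) |w|^{-1-α} dw] μ(dz)`
is well defined for `|x| < r` and equals `-∫_𝒮 |A(x)z|^α μ(dz)`. -/
theorem K_SFun_general (α : ℝ) (hα0 : 0 < α) (hα2 : α < 2)
    (d : ℕ) (hd : 1 ≤ d) (r : ℝ) (hr : 0 < r)
    (μ : Measure (EuclideanSpace ℝ (Fin d))) [IsFiniteMeasure μ]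
    (hμ : μ (Metric.sphere (0 : EuclideanSpace ℝ (Fin d)) 1)ᶜ = 0)
    (A : EuclideanSpace ℝ (Fin d) →
      (EuclideanSpace ℝ (Fin d) →ₗ[ℝ] EuclideanSpace ℝ (Fin d)))
    (x : EuclideanSpace ℝ (Fin d)) (hx : ‖x‖ < r) :
    ∃ g : EuclideanSpace ℝ (Fin d) → ℝ,
      (∀ z : EuclideanSpace ℝ (Fin d),
        Tendsto (fun ε : ℝ => ∫ w in {w : ℝ | ε < |w|},
            (SFun α r (x + w • (A x z)) - SFun α r x) * |w| ^ (-1 - α))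
          (𝓝[>] 0) (𝓝 (g z))) ∧
      Integrable g μ ∧
      ∫ z, g z ∂μ = -∫ z, ‖A x z‖ ^ α ∂μ := by
  refine ⟨fun z => -‖A x z‖ ^ α, fun z => aux_vec α hα0 hα2 d r x (A x z) hx, ?_, ?_⟩
  · have hcont : Continuous fun z => ‖A x z‖ ^ α :=
      ((A x).continuous_of_finiteDimensional.norm).rpow_const (fun _ => Or.inr hα0.le)
    obtain ⟨C, hC⟩ := (isCompact_sphere (0 : EuclideanSpace ℝ (Fin d)) 1).exists_bound_of_continuousOn
      hcont.continuousOn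
    refine Integrable.of_bound hcont.neg.aestronglyMeasurable C ?_
    have hae : ∀ᵐ z ∂μ, z ∈ Metric.sphere (0 : EuclideanSpace ℝ (Fin d)) 1 := by
      rw [ae_iff]; exact hμ
    filter_upwards [hae] with z hz
    simpa using hC z hz
  · exact integral_neg _
end

section
/- Let 0 < α < 2, d ≥ 1, r > 0, let c_α = α/(2·Γ(1−α/2)·Γ(1+α/2)), and define S_r : ℝ^d → ℝ by S_r(x) = c_α·((r² − |x|²)⁺)^{α/2}. Let μ be a finite (nonnegative) measure on the unit sphere 𝒮 = {z ∈ ℝ^d : |z| = 1}, and let A : ℝ^d → (ℝ^d →ₗ ℝ^d) be such that A(x) is a linear isometry of ℝ^d for every x with |x| < r. Then for every x ∈ ℝ^d with |x| < r, the iterated principal-value integral 𝒦 S_r(x) := ∫_𝒮 [ lim_{ε→0⁺} ∫_{|w|>ε} (S_r(x + A(x)z·w) − S_r(x))·|w|^{−1−α} dw ] μ(dz) is well defined and equals −μ(𝒮). -/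
open MeasureTheory Topology Filter Set

lemma aux_gamma (s P : ℝ) (hs0 : 0 < s) (hs1 : s < 1) (hP : 0 < P) :
    IntegrableOn (fun t : ℝ => t ^ (s - 1) / (t + P)) (Ioi 0) ∧
    ∫ t in Ioi (0:ℝ), t ^ (s - 1) / (t + P) =
      P ^ (s - 1) * (Real.Gamma s * Real.Gamma (1 - s)) := by
  set ν : Measure ℝ := volume.restrict (Ioi (0:ℝ)) with hν
  let F : ℝ × ℝ → ℝ := fun z => z.2 ^ (s - 1) * Real.exp (-(z.1 * (z.2 + P)))
  have hFm : AEStronglyMeasurable F (ν.prod ν) := by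
    apply Measurable.aestronglyMeasurable
    fun_prop
  have hx0 : ∀ᵐ x ∂ν, 0 < x := by
    filter_upwards [ae_restrict_mem measurableSet_Ioi] with x hx using hx
  have e1 : ∀ x : ℝ, (fun t => F (x, t)) = fun t => Real.exp (-(P * x)) *
      (t ^ (s - 1) * Real.exp (-(x * t))) := by
    intro x; ext t
    simp only [F]
    rw [show -(x * (t + P)) = -(P * x) + -(x * t) by ring, Real.exp_add]; ring
  have hG : ∀ x : ℝ, 0 < x → Integrable (fun t : ℝ => t ^ (s - 1) * Real.exp (-(x * t))) ν := by
    intro x hx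
    by_contra hcon
    have h1 := Real.integral_rpow_mul_exp_neg_mul_Ioi hs0 hx
    rw [integral_undef hcon] at h1
    have : 0 < (1 / x) ^ s * Real.Gamma s := by
      have := Real.Gamma_pos_of_pos hs0
      positivity
    linarith
  have i1 : ∀ x : ℝ, 0 < x → ∫ t, F (x, t) ∂ν =
      Real.Gamma s * (x ^ ((1 - s) - 1) * Real.exp (-(P * x))) := by
    intro x hx
    rw [e1, integral_const_mul, hν, Real.integral_rpow_mul_exp_neg_mul_Ioi hs0 hx]
    rw [one_div, Real.inv_rpow hx.le, ← Real.rpow_neg hx.le, show 1 - s - 1 = -s by ring]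
    ring
  have hI2 : Integrable (fun x : ℝ => x ^ ((1 - s) - 1) * Real.exp (-(P * x))) ν := by
    by_contra hcon
    have h1 := Real.integral_rpow_mul_exp_neg_mul_Ioi (a := 1 - s) (by linarith) hP
    rw [integral_undef hcon] at h1
    have : 0 < (1 / P) ^ (1 - s) * Real.Gamma (1 - s) := by
      have := Real.Gamma_pos_of_pos (s := 1 - s) (by linarith)
      positivity
    linarith
  have hFi : Integrable F (ν.prod ν) := by
    rw [integrable_prod_iff hFm]
    constructor
    · filter_upwards [hx0] with x hx
      rw [e1]
      exact (hG x hx).const_mul _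
    · refine (hI2.const_mul (Real.Gamma s)).congr ?_
      filter_upwards [hx0] with x hx
      rw [← i1 x hx]
      apply integral_congr_ae
      filter_upwards [hx0] with t ht
      rw [Real.norm_of_nonneg]
      simp only [F]
      positivity
  have i2 : ∀ t : ℝ, 0 < t → ∫ x, F (x, t) ∂ν = t ^ (s - 1) / (t + P) := by
    intro t ht
    simp only [F]
    rw [integral_const_mul]
    have := integral_exp_mul_Ioi (a := -(t + P)) (by linarith) 0
    have e : ∀ x : ℝ, -(x * (t + P)) = -(t + P) * x := fun x => by ring
    simp_rw [e]
    rw [hν, this]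
    simp [div_eq_mul_inv]
    rw [show -P + -t = -(t + P) by ring, inv_neg]; ring
  constructor
  · refine (hFi.swap.integral_prod_left).congr ?_
    filter_upwards [hx0] with t ht
    exact i2 t ht
  · have sw := integral_integral_swap (f := fun x t => F (x, t)) hFi
    have l : ∫ x, ∫ t, F (x, t) ∂ν ∂ν = P ^ (s - 1) * (Real.Gamma s * Real.Gamma (1 - s)) := by
      have : ∫ x, ∫ t, F (x, t) ∂ν ∂ν =
          ∫ x, Real.Gamma s * (x ^ ((1 - s) - 1) * Real.exp (-(P * x))) ∂ν := by
        apply integral_congr_ae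
        filter_upwards [hx0] with x hx using i1 x hx
      rw [this, integral_const_mul, hν,
        Real.integral_rpow_mul_exp_neg_mul_Ioi (by linarith) hP, one_div, Real.inv_rpow hP.le,
        ← Real.rpow_neg hP.le, show -(1 - s) = s - 1 by ring]
      ring
    rw [← l, sw]
    apply integral_congr_ae
    filter_upwards [hx0] with t ht
    exact (i2 t ht).symm

lemma aux_taylor (β : ℝ) : ∃ C : ℝ, 0 ≤ C ∧ ∀ x : ℝ, |x| ≤ 1/2 →
    |(1 + x) ^ β - 1 - β * x| ≤ C * x ^ 2 := by
  -- second derivative bound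
  have hc : ContinuousOn (fun x : ℝ => β * (β - 1) * x ^ (β - 2)) (Icc (1/2) (3/2)) := by
    apply ContinuousOn.mul continuousOn_const
    apply ContinuousOn.rpow_const continuousOn_id
    intro x hx; left; simp at *; linarith
  obtain ⟨C, hC⟩ := isCompact_Icc.exists_bound_of_continuousOn hc
  have hC0 : 0 ≤ C := le_trans (norm_nonneg _) (hC 1 (by norm_num))
  refine ⟨C, hC0, ?_⟩
  have key1 : ∀ x ∈ Icc (-(1/2):ℝ) (1/2), |β * (1 + x) ^ (β - 1) - β| ≤ C * |x| := by
    intro x hx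
    have := Convex.norm_image_sub_le_of_norm_hasDerivWithin_le (𝕜 := ℝ)
      (f := fun x : ℝ => β * x ^ (β - 1)) (f' := fun x => β * (β - 1) * x ^ (β - 2))
      (s := Icc (1/2:ℝ) (3/2)) (C := C) (x := 1) (y := 1 + x) ?_ hC (convex_Icc _ _) (by norm_num)
      (by simp at *; constructor <;> linarith)
    · simpa using this
    · intro y hy
      have hy0 : y ≠ 0 := by have := hy.1; intro h; rw [h] at this; norm_num at this
      have := ((Real.hasDerivAt_rpow_const (x := y) (p := β - 1) (Or.inl hy0)).const_mul β)
      convert this.hasDerivWithinAt using 1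
      rw [show β - 1 - 1 = β - 2 by ring]; ring
  intro x hx
  have hx' := abs_le.1 hx
  have := Convex.norm_image_sub_le_of_norm_hasDerivWithin_le (𝕜 := ℝ)
      (f := fun y : ℝ => (1 + y) ^ β - 1 - β * y) (f' := fun y => β * (1 + y) ^ (β - 1) - β)
      (s := Icc (-|x|) (|x|)) (C := C * |x|) (x := 0) (y := x) ?_ ?_ (convex_Icc _ _) (by simp)
      (by exact ⟨neg_abs_le x, le_abs_self x⟩)
  · simp only [add_zero, Real.one_rpow, sub_self, mul_zero, sub_zero, Real.norm_eq_abs] at this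
    rw [mul_assoc, ← sq, sq_abs] at this
    exact this
  · intro y hy
    have hy0 : 1 + y ≠ 0 := by have := hy.1; intro h; linarith
    have h1 := ((hasDerivAt_id y).const_add 1).rpow_const (p := β) (Or.inl hy0)
    have h2 := (h1.sub_const 1).sub ((hasDerivAt_id y).const_mul β)
    refine (h2.congr_deriv ?_).hasDerivWithinAt
    simp
  · intro y hy
    rw [Real.norm_eq_abs]
    refine (key1 y ⟨by linarith [hy.1], by linarith [hy.2]⟩).trans ?_
    exact mul_le_mul_of_nonneg_left (abs_le.2 hy) hC0

lemma aux_asymp (s m ρ : ℝ) (hs0 : 0 < s) (hs1 : s < 1) :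
    Tendsto (fun Y : ℝ => 2 * (Y ^ 2 - ρ ^ 2) ^ s - (Y + m) ^ (2 * s) - (Y - m) ^ (2 * s))
      atTop (𝓝 0) := by
  obtain ⟨C₁, hC₁, h1⟩ := aux_taylor s
  obtain ⟨C₂, hC₂, h2⟩ := aux_taylor (2 * s)
  set K := 2 * (C₁ * ρ ^ 4 + s * ρ ^ 2) + 2 * (C₂ * m ^ 2) with hK
  have hlim : Tendsto (fun Y : ℝ => K * Y ^ (-(2 - 2 * s))) atTop (𝓝 0) := by
    simpa using (tendsto_rpow_neg_atTop (y := 2 - 2 * s) (by linarith)).const_mul K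
  refine squeeze_zero_norm' ?_ hlim
  filter_upwards [eventually_ge_atTop 1, eventually_ge_atTop (2 * |m|),
    eventually_ge_atTop (2 * |ρ|)] with Y hY1 hYm hYρ
  have hY : 0 < Y := by linarith
  have a1 : |m / Y| ≤ 1 / 2 := by
    rw [abs_div, abs_of_pos hY, div_le_div_iff₀ hY (by norm_num)]; linarith
  have a1' : |-(m / Y)| ≤ 1 / 2 := by rwa [abs_neg]
  have a2 : |ρ / Y| ≤ 1 / 2 := by
    rw [abs_div, abs_of_pos hY, div_le_div_iff₀ hY (by norm_num)]; linarith
  have a3' : (ρ / Y) ^ 2 ≤ 1 / 2 := by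
    rw [← sq_abs]; nlinarith [abs_nonneg (ρ / Y)]
  have a3 : |-((ρ / Y) ^ 2)| ≤ 1 / 2 := by
    rw [abs_neg, abs_of_nonneg (sq_nonneg _)]; exact a3'
  have b1 := h2 _ a1
  have b2 := h2 _ a1'
  have b3 := h1 _ a3
  have e1 : (Y + m) ^ (2 * s) = Y ^ (2 * s) * (1 + m / Y) ^ (2 * s) := by
    rw [← Real.mul_rpow hY.le (by linarith [(abs_le.1 a1).1])]
    congr 1; field_simp
  have e2 : (Y - m) ^ (2 * s) = Y ^ (2 * s) * (1 + -(m / Y)) ^ (2 * s) := by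
    rw [← Real.mul_rpow hY.le (by linarith [(abs_le.1 a1).2])]
    congr 1; field_simp; ring
  have e3 : (Y ^ 2 - ρ ^ 2) ^ s = Y ^ (2 * s) * (1 + -((ρ / Y) ^ 2)) ^ s := by
    rw [Real.rpow_mul hY.le, ← Real.mul_rpow (by positivity) (by linarith)]
    congr 1; rw [Real.rpow_two]; field_simp; ring
  rw [e1, e2, e3]
  have hpow : Y ^ (-(2 - 2 * s)) = Y ^ (2 * s) * (1 / Y ^ 2) := by
    rw [show -(2 - 2 * s) = 2 * s - 2 by ring, Real.rpow_sub hY, Real.rpow_two]; ring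
  rw [hpow, Real.norm_eq_abs]
  have fac : ∀ X A B D : ℝ, 2 * (X * A) - X * B - X * D = X * (2 * A - B - D) := by
    intros; ring
  rw [fac, abs_mul, abs_of_pos (Real.rpow_pos_of_pos hY _),
    show K * (Y ^ (2 * s) * (1 / Y ^ 2)) = Y ^ (2 * s) * (K * (1 / Y ^ 2)) by ring]
  gcongr
  have q1 : (m / Y) ^ 2 = m ^ 2 * (1 / Y ^ 2) := by ring
  have q2 : (ρ / Y) ^ 2 = ρ ^ 2 * (1 / Y ^ 2) := by ring
  have q3 : (-((ρ / Y) ^ 2)) ^ 2 ≤ ρ ^ 4 * (1 / Y ^ 2) := by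
    have : (-((ρ / Y) ^ 2)) ^ 2 = ρ ^ 4 * (1 / Y ^ 2) * (1 / Y ^ 2) := by ring
    rw [this]
    apply mul_le_of_le_one_right (by positivity)
    rw [div_le_one (by positivity)]
    nlinarith
  have q4 := mul_le_mul_of_nonneg_left q3 hC₁
  rw [neg_sq, q1] at b2
  rw [q1] at b1
  rw [abs_le] at *
  obtain ⟨b11, b12⟩ := b1
  obtain ⟨b21, b22⟩ := b2
  obtain ⟨b31, b32⟩ := b3
  have q5 : 0 ≤ s * ρ ^ 2 * (1 / Y ^ 2) := by positivity
  have q6 : s * (-((ρ / Y) ^ 2)) = - (s * ρ ^ 2 * (1 / Y ^ 2)) := by ring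
  rw [q6] at b31 b32
  have q7 : K * (1 / Y ^ 2) = 2 * (C₁ * (ρ ^ 4 * (1 / Y ^ 2)) + s * ρ ^ 2 * (1 / Y ^ 2))
    + 2 * (C₂ * (m ^ 2 * (1 / Y ^ 2))) := by rw [hK]; ring
  rw [q7]
  constructor <;> linarith

/-- Normalised one-dimensional profile. -/
noncomputable def auxF (s m P w : ℝ) : ℝ := (max (1 - 2 * m * w - P * w ^ 2) 0) ^ s

/-- Integrand. -/
noncomputable def auxI (s m P w : ℝ) : ℝ := (auxF s m P w - 1) * w ^ (-1 - 2 * s)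

/-- One-sided truncated integral. -/
noncomputable def auxPhi (s m P ε : ℝ) : ℝ := ∫ w in Ioi ε, auxI s m P w

lemma auxF_cont (s m P : ℝ) (hs0 : 0 < s) : Continuous (auxF s m P) := by
  unfold auxF
  apply Continuous.rpow_const (by fun_prop)
  intro x; right; exact hs0.le

lemma auxI_cont (s m P : ℝ) (hs0 : 0 < s) : ContinuousOn (auxI s m P) (Ioi 0) := by
  unfold auxI
  apply ContinuousOn.mul ((auxF_cont s m P hs0).continuousOn.sub continuousOn_const)
  apply ContinuousOn.rpow_const continuousOn_id
  intro x hx; left; exact (ne_of_gt hx)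

lemma auxF_bound (s m P : ℝ) (hs0 : 0 < s) (hP : 0 < P) (w : ℝ) :
    |auxF s m P w - 1| ≤ (1 + m ^ 2 / P) ^ s := by
  have h1 : 0 ≤ auxF s m P w := by unfold auxF; positivity
  have h2 : auxF s m P w ≤ (1 + m ^ 2 / P) ^ s := by
    unfold auxF
    apply Real.rpow_le_rpow (by positivity) _ hs0.le
    apply max_le _ (by positivity)
    have : 1 + m ^ 2 / P - (1 - 2 * m * w - P * w ^ 2) = (m + P * w) ^ 2 / P := by
      field_simp; ring
    have h3 : 0 ≤ (m + P * w) ^ 2 / P := by positivity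
    linarith
  have h4 : 1 ≤ (1 + m ^ 2 / P) ^ s := by
    apply Real.one_le_rpow _ hs0.le
    have : 0 ≤ m ^ 2 / P := by positivity
    linarith
  rw [abs_le]; constructor <;> linarith

lemma auxI_int (s m P ε : ℝ) (hs0 : 0 < s) (hP : 0 < P) (hε : 0 < ε) :
    IntegrableOn (auxI s m P) (Ioi ε) := by
  have h1 : IntegrableOn (fun w : ℝ => w ^ (-1 - 2 * s)) (Ioi ε) :=
    integrableOn_Ioi_rpow_of_lt (by linarith) hε
  refine (h1.const_mul ((1 + m ^ 2 / P) ^ s)).mono' ?_ ?_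
  · exact ((auxI_cont s m P hs0).mono (Ioi_subset_Ioi hε.le)).aestronglyMeasurable measurableSet_Ioi
  · filter_upwards [ae_restrict_mem measurableSet_Ioi] with w hw
    have hw0 : 0 < w := lt_trans hε hw
    unfold auxI
    rw [norm_mul, Real.norm_eq_abs, Real.norm_eq_abs, abs_of_pos (Real.rpow_pos_of_pos hw0 _)]
    have := auxF_bound s m P hs0 hP w
    gcongr

lemma auxPhi_sub (s m P a b : ℝ) (hs0 : 0 < s) (hP : 0 < P) (ha : 0 < a) (hb : 0 < b) :
    auxPhi s m P a - auxPhi s m P b = ∫ w in a..b, auxI s m P w := by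
  unfold auxPhi
  exact (intervalIntegral.integral_Ioi_sub_Ioi' (auxI_int s m P a hs0 hP ha) (auxI_int s m P b hs0 hP hb))

lemma auxPhi_deriv (s m P a : ℝ) (hs0 : 0 < s) (hP : 0 < P) (ha : 0 < a) :
    HasDerivAt (auxPhi s m P) (- auxI s m P a) a := by
  have hc : ContinuousAt (auxI s m P) a := (auxI_cont s m P hs0).continuousAt (Ioi_mem_nhds ha)
  have h1 : HasDerivAt (fun b => ∫ w in a..b, auxI s m P w) (auxI s m P a) a := by
    apply intervalIntegral.integral_hasDerivAt_right
    · simp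
    · exact (auxI_cont s m P hs0).stronglyMeasurableAtFilter isOpen_Ioi a ha
    · exact hc
  have h2 := h1.const_sub (auxPhi s m P a)
  refine h2.congr_of_eventuallyEq ?_
  filter_upwards [Ioi_mem_nhds ha] with b hb
  rw [← auxPhi_sub s m P a b hs0 hP ha hb]; ring

lemma auxF_inv (s m P y : ℝ) (hy : 0 < y + m) :
    auxF s m P (1 / (y + m)) = (max (y ^ 2 - (m ^ 2 + P)) 0) ^ s * (y + m) ^ (-(2 * s)) := by
  unfold auxF
  have e : 1 - 2 * m * (1 / (y + m)) - P * (1 / (y + m)) ^ 2 =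
      (y ^ 2 - (m ^ 2 + P)) * ((y + m) ^ (-2 : ℝ)) := by
    rw [Real.rpow_neg hy.le, Real.rpow_two]
    field_simp; ring
  have hp : 0 < (y + m) ^ (-2 : ℝ) := Real.rpow_pos_of_pos hy _
  rw [e]
  have : max ((y ^ 2 - (m ^ 2 + P)) * ((y + m) ^ (-2 : ℝ))) 0 =
     max (y ^ 2 - (m ^ 2 + P)) 0 * (y + m) ^ (-2 : ℝ) := by
    rw [max_mul_of_nonneg _ _ hp.le, zero_mul]
  rw [this, Real.mul_rpow (le_max_right _ _) hp.le, ← Real.rpow_mul hy.le]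
  congr 2; ring

/-- primitive in the `y` variable -/
lemma auxOmega_deriv (s m P y : ℝ) (hs0 : 0 < s) (hP : 0 < P) (hy : 0 < y + m) :
    HasDerivAt (fun y => auxPhi s m P (1 / (y + m)) + (y + m) ^ (2 * s) / (2 * s))
      ((max (y ^ 2 - (m ^ 2 + P)) 0) ^ s / (y + m)) y := by
  have hd : HasDerivAt (fun y : ℝ => y + m) 1 y := (hasDerivAt_id y).add_const m
  have hinv : HasDerivAt (fun y : ℝ => 1 / (y + m)) (-1 / (y + m) ^ 2) y := by
    have := hd.inv hy.ne'
    simp only [one_div]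
    exact this
  have h1 := (auxPhi_deriv s m P (1 / (y + m)) hs0 hP (by positivity)).comp y hinv
  have h2 := (hd.rpow_const (p := 2 * s) (Or.inl hy.ne')).div_const (2 * s)
  refine (h1.add h2).congr_deriv ?_
  unfold auxI
  rw [auxF_inv s m P y hy]
  have e1 : (1 / (y + m)) ^ (-1 - 2 * s) = (y + m) ^ (2 * s) * (y + m) := by
    rw [one_div, Real.inv_rpow hy.le, ← Real.rpow_neg hy.le, ← Real.rpow_add_one hy.ne']
    congr 1; ring
  have e2 : (y + m) ^ (2 * s - 1) = (y + m) ^ (2 * s) / (y + m) := Real.rpow_sub_one hy.ne' _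
  have e3 : (y + m) ^ (-(2 * s)) = ((y + m) ^ (2 * s))⁻¹ := Real.rpow_neg hy.le _
  have hp : 0 < (y + m) ^ (2 * s) := Real.rpow_pos_of_pos hy _
  rw [e1, e2, e3]
  generalize (y + m) ^ (2 * s) = X at *
  field_simp
  ring

lemma auxOmega_zero (s m P ρ : ℝ) (hs0 : 0 < s) (hP : 0 < P) (hρ0 : 0 ≤ ρ)
    (hρ : ρ ^ 2 = m ^ 2 + P) (hy : 0 < ρ + m) :
    auxPhi s m P (1 / (ρ + m)) + (ρ + m) ^ (2 * s) / (2 * s) = 0 := by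
  have hε : 0 < 1 / (ρ + m) := by positivity
  have : auxPhi s m P (1 / (ρ + m)) = ∫ w in Ioi (1 / (ρ + m)), - w ^ (-1 - 2 * s) := by
    apply setIntegral_congr_fun measurableSet_Ioi
    intro w hw
    have hw0 : 0 < w := lt_trans hε hw
    have hz : auxF s m P w = 0 := by
      unfold auxF
      rw [max_eq_right, Real.zero_rpow hs0.ne']
      have h1 : 1 < w * (ρ + m) := by
        have := (div_lt_iff₀ hy).1 hw
        exact this
      have h2 : 0 ≤ ρ - m := by
        have : |m| ≤ |ρ| := sq_le_sq.1 (by rw [hρ]; linarith)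
        rw [abs_of_nonneg hρ0] at this
        linarith [le_abs_self m]
      have h3 : P = (ρ - m) * (ρ + m) := by linarith
      rw [h3]
      nlinarith [mul_nonneg (sub_nonneg.2 h1.le) (mul_nonneg h2 hw0.le)]
    simp only [auxI, hz]; ring
  rw [this, integral_neg, integral_Ioi_rpow_of_lt (by linarith) hε, one_div, Real.inv_rpow hy.le,
    ← Real.rpow_neg hy.le, show -(-1 - 2 * s + 1) = 2 * s by ring,
    show -1 - 2 * s + 1 = -(2 * s) by ring]
  field_simp; ring

lemma auxOmega_eq (s m P ρ Y : ℝ) (hs0 : 0 < s) (hP : 0 < P) (hρ0 : 0 ≤ ρ)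
    (hρ : ρ ^ 2 = m ^ 2 + P) (hy : 0 < ρ + m) (hY : ρ ≤ Y) :
    auxPhi s m P (1 / (Y + m)) + (Y + m) ^ (2 * s) / (2 * s) =
     ∫ y in ρ..Y, (max (y ^ 2 - ρ ^ 2) 0) ^ s / (y + m) ∧
    IntervalIntegrable (fun y => (max (y ^ 2 - ρ ^ 2) 0) ^ s / (y + m)) volume ρ Y := by
  have hi : IntervalIntegrable (fun y => (max (y ^ 2 - ρ ^ 2) 0) ^ s / (y + m)) volume ρ Y := by
    apply ContinuousOn.intervalIntegrable
    apply ContinuousOn.div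
    · apply ContinuousOn.rpow_const (by fun_prop)
      intro x _; right; exact hs0.le
    · fun_prop
    · intro x hx
      rw [uIcc_of_le hY] at hx
      have := hx.1
      exact ne_of_gt (by linarith)
  refine ⟨?_, hi⟩
  rw [intervalIntegral.integral_eq_sub_of_hasDerivAt (f := fun y => auxPhi s m P (1 / (y + m)) + (y + m) ^ (2 * s) / (2 * s)) _ hi]
  · rw [auxOmega_zero s m P ρ hs0 hP hρ0 hρ hy, sub_zero]
  · intro y hy'
    rw [uIcc_of_le hY] at hy'
    rw [hρ]
    exact auxOmega_deriv s m P y hs0 hP (by linarith [hy'.1])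

lemma auxT_eq (s P T : ℝ) (hs0 : 0 < s) (hs1 : s < 1) (hP : 0 < P) (hT : 0 ≤ T) :
    ∫ t in (0:ℝ)..T, t ^ s / (t + P) =
      T ^ s / s - P * ∫ t in (0:ℝ)..T, t ^ (s - 1) / (t + P) := by
  have hi := (aux_gamma s P hs0 hs1 hP).1
  have h1 : IntervalIntegrable (fun t : ℝ => t ^ (s - 1) / (t + P)) volume 0 T := by
    rw [intervalIntegrable_iff_integrableOn_Ioc_of_le hT]
    exact hi.mono_set Ioc_subset_Ioi_self
  have h2 : IntervalIntegrable (fun t : ℝ => t ^ (s - 1)) volume 0 T :=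
    intervalIntegral.intervalIntegrable_rpow' (by linarith)
  have h3 : ∫ t in (0:ℝ)..T, t ^ (s - 1) = T ^ s / s := by
    rw [integral_rpow (Or.inl (by linarith))]
    simp [hs0.ne']
  rw [← h3, ← intervalIntegral.integral_const_mul, ← intervalIntegral.integral_sub h2 (h1.const_mul P)]
  apply intervalIntegral.integral_congr_ae
  filter_upwards with t ht
  rw [uIoc_of_le hT] at ht
  have ht0 : 0 < t := ht.1
  rw [Real.rpow_sub_one ht0.ne']
  field_simp
  ring

lemma auxSum_eq (s m P ρ Y : ℝ) (hs0 : 0 < s) (hP : 0 < P) (hρ0 : 0 ≤ ρ)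
    (hρ : ρ ^ 2 = m ^ 2 + P) (hy : 0 < ρ + m) (hy' : 0 < ρ - m) (hY : ρ ≤ Y) :
    auxPhi s m P (1 / (Y + m)) + auxPhi s (-m) P (1 / (Y - m)) =
     (∫ t in (0:ℝ)..(Y ^ 2 - ρ ^ 2), t ^ s / (t + P))
       - ((Y + m) ^ (2 * s) + (Y - m) ^ (2 * s)) / (2 * s) := by
  obtain ⟨a1, a2⟩ := auxOmega_eq s m P ρ Y hs0 hP hρ0 hρ hy hY
  obtain ⟨b1, b2⟩ := auxOmega_eq s (-m) P ρ Y hs0 hP hρ0 (by rw [neg_sq, hρ]) (by linarith) hY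
  have key : ∫ t in (0:ℝ)..(Y ^ 2 - ρ ^ 2), t ^ s / (t + P) =
      ∫ y in ρ..Y, ((max (y ^ 2 - ρ ^ 2) 0) ^ s / (y + m) +
        (max (y ^ 2 - ρ ^ 2) 0) ^ s / (y + -m)) := by
    have sub := intervalIntegral.integral_comp_mul_deriv'' (a := ρ) (b := Y)
      (f := fun y => y ^ 2 - ρ ^ 2) (f' := fun y => 2 * y) (g := fun t => t ^ s / (t + P))
      (by fun_prop) ?_ (by fun_prop) ?_
    · simp only [sub_self] at sub
      rw [← sub]
      apply intervalIntegral.integral_congr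
      intro y hyy
      rw [uIcc_of_le hY] at hyy
      have h1 : ρ ≤ y := hyy.1
      have h2 : 0 ≤ y ^ 2 - ρ ^ 2 := by nlinarith
      have h3 : 0 < y + m := by linarith
      have h4 : 0 < y + -m := by linarith
      simp only [Function.comp]
      rw [max_eq_left h2]
      have : y ^ 2 - ρ ^ 2 + P = (y + m) * (y + -m) := by rw [hρ]; ring
      rw [this]
      field_simp
      ring
    · intro y _
      have := ((hasDerivAt_pow 2 y).sub_const (ρ ^ 2)).hasDerivWithinAt (s := Ioi y)
      simpa using this
    · rintro _ ⟨y, hyy, rfl⟩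
      rw [uIcc_of_le hY] at hyy
      have h2 : 0 ≤ y ^ 2 - ρ ^ 2 := by nlinarith [hyy.1]
      apply ContinuousWithinAt.div
      · exact (Real.continuousAt_rpow_const _ _ (Or.inr hs0.le)).continuousWithinAt
      · fun_prop
      · simp only; positivity
  rw [key, intervalIntegral.integral_add a2 b2, ← a1, ← b1, ← sub_eq_add_neg]
  ring

lemma auxSum_lim (s m P : ℝ) (hs0 : 0 < s) (hs1 : s < 1) (hP : 0 < P) :
    Tendsto (fun Y => auxPhi s m P (1 / (Y + m)) + auxPhi s (-m) P (1 / (Y - m))) atTop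
      (𝓝 (- (P ^ s * (Real.Gamma s * Real.Gamma (1 - s))))) := by
  set ρ := √(m ^ 2 + P) with hρd
  have hρ0 : 0 ≤ ρ := Real.sqrt_nonneg _
  have hρ : ρ ^ 2 = m ^ 2 + P := Real.sq_sqrt (by positivity)
  have hm : |m| < ρ := by
    apply Real.lt_sqrt_of_sq_lt; rw [sq_abs]; linarith
  have hm1 := abs_lt.1 hm
  obtain ⟨hi, hv⟩ := aux_gamma s P hs0 hs1 hP
  have hT : Tendsto (fun Y : ℝ => Y ^ 2 - ρ ^ 2) atTop atTop :=
    tendsto_atTop_add_const_right _ _ (tendsto_pow_atTop (by norm_num))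
  have l1 := (intervalIntegral_tendsto_integral_Ioi 0 hi hT).const_mul P
  have l2 := (aux_asymp s m ρ hs0 hs1).div_const (2 * s)
  have l3 := l2.sub l1
  rw [hv, zero_div, zero_sub] at l3
  have : P * (P ^ (s - 1) * (Real.Gamma s * Real.Gamma (1 - s))) =
      (P ^ s * (Real.Gamma s * Real.Gamma (1 - s))) := by
    rw [Real.rpow_sub_one hP.ne']; field_simp
  rw [this] at l3
  refine l3.congr' ?_
  filter_upwards [eventually_ge_atTop ρ] with Y hY
  rw [auxSum_eq s m P ρ Y hs0 hP hρ0 hρ (by linarith) (by linarith) hY,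
    auxT_eq s P _ hs0 hs1 hP (by nlinarith)]
  field_simp
  ring

lemma auxShift (s m P : ℝ) (hs0 : 0 < s) (hs1 : s < 1) (hP : 0 < P) :
    Tendsto (fun Y => auxPhi s m P (1 / Y) - auxPhi s m P (1 / (Y + m))) atTop (𝓝 0) := by
  have hd : (fun w => auxF s m P w - 1) =O[𝓝 0] fun w => w := by
    have : DifferentiableAt ℝ (fun w : ℝ => (1 - 2 * m * w - P * w ^ 2) ^ s) 0 := by
      apply DifferentiableAt.rpow_const (by fun_prop)
      left; norm_num
    have h2 := this.isBigO_sub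
    simp only [mul_zero, ne_eq, OfNat.ofNat_ne_zero, not_false_eq_true, zero_pow, sub_zero, Real.one_rpow] at h2
    refine h2.congr' ?_ (Eventually.of_forall fun _ => rfl)
    have hpos : ∀ᶠ w in 𝓝 (0:ℝ), 0 < 1 - 2 * m * w - P * w ^ 2 := by
      apply ContinuousAt.eventually_lt (by fun_prop) (by fun_prop)
      norm_num
    filter_upwards [hpos] with w hw
    unfold auxF
    rw [max_eq_left hw.le]
  obtain ⟨C, hC0, hC⟩ := hd.exists_pos
  rw [Asymptotics.isBigOWith_iff, Metric.eventually_nhds_iff] at hC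
  obtain ⟨δ, hδ, hC⟩ := hC
  set K := C * (1 / 2) ^ (-(2 * s)) * (2 * |m|) with hK
  have hlim : Tendsto (fun Y : ℝ => K * Y ^ (-(2 - 2 * s))) atTop (𝓝 0) := by
    simpa using (tendsto_rpow_neg_atTop (y := 2 - 2 * s) (by linarith)).const_mul K
  refine squeeze_zero_norm' ?_ hlim
  filter_upwards [eventually_ge_atTop 1, eventually_ge_atTop (2 * |m|),
    eventually_gt_atTop (2 / δ)] with Y hY1 hYm hYδ
  have hY : 0 < Y := by linarith
  have hm1 := le_abs_self m
  have hm2 := neg_abs_le m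
  have hYm1 : Y / 2 ≤ Y + m := by linarith
  have hYm2 : Y + m ≤ 2 * Y := by linarith
  have hYm0 : 0 < Y + m := by linarith
  rw [auxPhi_sub s m P _ _ hs0 hP (by positivity) (by positivity)]
  have hb : ∀ w ∈ Set.uIoc (1 / Y) (1 / (Y + m)), ‖auxI s m P w‖ ≤ C * ((1 / 2) ^ (-(2 * s)) * Y ^ (2 * s)) := by
    intro w hw
    have u1 : 1 / 2 * Y⁻¹ ≤ 1 / Y := by
      rw [one_div Y]; have : 0 < Y⁻¹ := by positivity
      linarith
    have u2 : 1 / 2 * Y⁻¹ ≤ 1 / (Y + m) := by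
      rw [← one_div, div_mul_div_comm, one_mul]
      exact one_div_le_one_div_of_le hYm0 hYm2
    have u3 : 1 / Y ≤ 2 / Y := by gcongr; norm_num
    have u4 : 1 / (Y + m) ≤ 2 / Y := by
      rw [div_le_div_iff₀ hYm0 hY]; linarith
    have hw1 : 1 / 2 * Y⁻¹ < w := lt_of_le_of_lt (le_min u1 u2) hw.1
    have hw2 : w ≤ 2 / Y := hw.2.trans (max_le u3 u4)
    have hw0 : 0 < w := lt_trans (by positivity) hw1
    have hwδ : w < δ := by
      refine lt_of_le_of_lt hw2 ?_
      rw [div_lt_iff₀ hδ] at hYδ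
      rw [div_lt_iff₀ hY]; linarith
    have hc := hC (y := w) (by simpa [abs_of_pos hw0] using hwδ)
    rw [Real.norm_eq_abs w, abs_of_pos hw0] at hc
    unfold auxI
    rw [norm_mul, Real.norm_of_nonneg (Real.rpow_nonneg hw0.le _)]
    calc _ ≤ (C * w) * w ^ (-1 - 2 * s) := by gcongr
      _ = C * w ^ (-(2 * s)) := by
        rw [show -(2 * s) = (-1 - 2 * s) + 1 by ring, Real.rpow_add_one hw0.ne']; ring
      _ ≤ C * ((1 / 2 * Y⁻¹) ^ (-(2 * s))) := by
        apply mul_le_mul_of_nonneg_left _ hC0.le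
        apply Real.rpow_le_rpow_of_nonpos (by positivity) hw1.le (by linarith)
      _ = _ := by
        rw [Real.mul_rpow (by norm_num) (by positivity), Real.inv_rpow hY.le, Real.rpow_neg hY.le, inv_inv]
  refine (intervalIntegral.norm_integral_le_of_norm_le_const hb).trans ?_
  have hw : |1 / (Y + m) - 1 / Y| ≤ 2 * |m| * (1 / Y ^ 2) := by
    have : 1 / (Y + m) - 1 / Y = - m / ((Y + m) * Y) := by field_simp; ring
    rw [this, abs_div, abs_neg, abs_of_pos (by positivity : 0 < (Y + m) * Y),
      mul_one_div, div_le_div_iff₀ (by positivity) (by positivity)]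
    have := mul_le_mul_of_nonneg_left hYm1 hY.le
    nlinarith [abs_nonneg m, mul_le_mul_of_nonneg_left this (abs_nonneg m)]
  have hpow : Y ^ (-(2 - 2 * s)) = Y ^ (2 * s) * (1 / Y ^ 2) := by
    rw [show -(2 - 2 * s) = 2 * s - 2 by ring, Real.rpow_sub hY, Real.rpow_two]; ring
  rw [hpow]
  calc _ ≤ C * ((1 / 2) ^ (-(2 * s)) * Y ^ (2 * s)) * (2 * |m| * (1 / Y ^ 2)) := by gcongr
    _ = _ := by rw [hK]; ring

lemma auxSym_lim (s m P : ℝ) (hs0 : 0 < s) (hs1 : s < 1) (hP : 0 < P) :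
    Tendsto (fun ε => auxPhi s m P ε + auxPhi s (-m) P ε) (𝓝[>] 0)
      (𝓝 (- (P ^ s * (Real.Gamma s * Real.Gamma (1 - s))))) := by
  have h := ((auxSum_lim s m P hs0 hs1 hP).add (auxShift s m P hs0 hs1 hP)).add
    (auxShift s (-m) P hs0 hs1 hP)
  have h2 := h.comp tendsto_inv_nhdsGT_zero
  rw [add_zero, add_zero] at h2
  refine h2.congr ?_
  intro ε
  simp only [Function.comp, one_div, inv_inv, ← sub_eq_add_neg]
  ring

lemma aux_pv (s m P : ℝ) (hs0 : 0 < s) (hs1 : s < 1) (hP : 0 < P) :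
    Tendsto (fun ε : ℝ => ∫ w in {w : ℝ | ε < |w|}, (auxF s m P w - 1) * |w| ^ (-1 - 2 * s))
      (𝓝[>] 0) (𝓝 (- (P ^ s * (Real.Gamma s * Real.Gamma (1 - s))))) := by
  refine (auxSym_lim s m P hs0 hs1 hP).congr' ?_
  filter_upwards [self_mem_nhdsWithin] with ε hε
  have hε : 0 < ε := hε
  have hset : {w : ℝ | ε < |w|} = Ioi ε ∪ Iio (-ε) := by
    ext w; simp only [mem_ofPred_eq, lt_abs, mem_union, mem_Ioi, mem_Iio]
    constructor <;> rintro (h | h) <;> [left; right; left; right] <;> linarith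
  set J : ℝ → ℝ := fun w => (auxF s m P w - 1) * |w| ^ (-1 - 2 * s) with hJ
  have e1 : EqOn (auxI s m P) J (Ioi ε) := by
    intro w hw
    simp only [hJ, auxI]
    rw [abs_of_pos (lt_trans hε hw)]
  have e2 : EqOn (auxI s (-m) P) (fun w => J (-w)) (Ioi ε) := by
    intro w hw
    simp only [hJ, auxI, auxF]
    rw [abs_neg, abs_of_pos (lt_trans hε hw)]
    ring_nf
  have i1 : IntegrableOn J (Ioi ε) := (auxI_int s m P ε hs0 hP hε).congr_fun e1 measurableSet_Ioi
  have i2 : IntegrableOn (fun w => J (-w)) (Ioi ε) :=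
    (auxI_int s (-m) P ε hs0 hP hε).congr_fun e2 measurableSet_Ioi
  have i3 : IntegrableOn J (Iio (-ε)) := by
    have := i2.comp_neg
    simpa using this
  rw [hset, setIntegral_union _ measurableSet_Iio i1 i3]
  · unfold auxPhi
    rw [setIntegral_congr_fun measurableSet_Ioi e1, setIntegral_congr_fun measurableSet_Ioi e2,
      integral_comp_neg_Ioi, integral_Iic_eq_integral_Iio]
  · rw [Set.disjoint_left]; intro w hw hw'
    simp only [mem_Ioi, mem_Iio] at *; linarith

/-- If `A(x)` is a linear isometry for all `|x| < r`, then the iterated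
principal-value integral
`𝒦 S_r(x) = ∫_𝒮 [p.v. ∫ (S_r(x + A(x)z w) - S_r(x)) |w|^{-1-α} dw] μ(dz)`
equals `-μ(𝒮)` for `|x| < r`. -/
theorem K_SFun_isometry (α : ℝ) (hα0 : 0 < α) (hα2 : α < 2)
    (d : ℕ) (hd : 1 ≤ d) (r : ℝ) (hr : 0 < r)
    (μ : Measure (EuclideanSpace ℝ (Fin d))) [IsFiniteMeasure μ]
    (hμ : μ (Metric.sphere (0 : EuclideanSpace ℝ (Fin d)) 1)ᶜ = 0)
    (A : EuclideanSpace ℝ (Fin d) →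
      (EuclideanSpace ℝ (Fin d) →ₗ[ℝ] EuclideanSpace ℝ (Fin d)))
    (hA : ∀ x : EuclideanSpace ℝ (Fin d), ‖x‖ < r →
      ∀ y : EuclideanSpace ℝ (Fin d), ‖A x y‖ = ‖y‖)
    (x : EuclideanSpace ℝ (Fin d)) (hx : ‖x‖ < r) :
    ∃ g : EuclideanSpace ℝ (Fin d) → ℝ,
      (∀ z : EuclideanSpace ℝ (Fin d),
        Tendsto (fun ε : ℝ => ∫ w in {w : ℝ | ε < |w|},
            (SFun α r (x + w • (A x z)) - SFun α r x) * |w| ^ (-1 - α))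
          (𝓝[>] 0) (𝓝 (g z))) ∧
      Integrable g μ ∧
      ∫ z, g z ∂μ =
        -(μ (Metric.sphere (0 : EuclideanSpace ℝ (Fin d)) 1)).toReal := by
  have hs0 : 0 < α / 2 := by linarith
  have hs1 : α / 2 < 1 := by linarith
  have hG1 : 0 < Real.Gamma (α / 2) := Real.Gamma_pos_of_pos hs0
  have hG2 : 0 < Real.Gamma (1 - α / 2) := Real.Gamma_pos_of_pos (by linarith)
  have hc : cAlpha α * (Real.Gamma (α / 2) * Real.Gamma (1 - α / 2)) = 1 := by
    unfold cAlpha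
    rw [add_comm 1 (α / 2), Real.Gamma_add_one hs0.ne']
    generalize Real.Gamma (1 - α / 2) = G at *
    field_simp
  set Q := r ^ 2 - ‖x‖ ^ 2 with hQd
  have hQ : 0 < Q := by
    have := norm_nonneg x
    nlinarith
  have hae : ∀ᵐ z ∂μ, -‖z‖ ^ α = -1 := by
    have : ∀ᵐ z ∂μ, z ∈ Metric.sphere (0 : EuclideanSpace ℝ (Fin d)) 1 := hμ
    filter_upwards [this] with z hz
    rw [mem_sphere_zero_iff_norm] at hz
    rw [hz, Real.one_rpow]
  refine ⟨fun z => -‖z‖ ^ α, ?_, ?_, ?_⟩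
  · intro z
    have hv : ‖A x z‖ = ‖z‖ := hA x hx z
    have hS0 : SFun α r x = cAlpha α * Q ^ (α / 2) := by
      unfold SFun
      rw [max_eq_left hQ.le]
    by_cases hz : z = 0
    · subst hz
      simp [Real.zero_rpow hα0.ne']
    have hz0 : 0 < ‖z‖ := norm_pos_iff.2 hz
    set m := inner ℝ x (A x z) / Q with hm
    set P := ‖z‖ ^ 2 / Q with hPd
    have hP : 0 < P := by positivity
    have hS : ∀ w : ℝ, SFun α r (x + w • (A x z)) =
        cAlpha α * Q ^ (α / 2) * auxF (α / 2) m P w := by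
      intro w
      unfold SFun auxF
      have e : r ^ 2 - ‖x + w • (A x z)‖ ^ 2 = Q * (1 - 2 * m * w - P * w ^ 2) := by
        rw [norm_add_sq_real, inner_smul_right, norm_smul, hv, mul_pow, Real.norm_eq_abs, sq_abs,
          hm, hPd]
        field_simp
        rw [hQd]
        ring
      have e2 : max (Q * (1 - 2 * m * w - P * w ^ 2)) 0 =
          Q * max (1 - 2 * m * w - P * w ^ 2) 0 := by
        rw [mul_max_of_nonneg _ _ hQ.le, mul_zero]
      rw [e, e2, Real.mul_rpow hQ.le (le_max_right _ _)]
      ring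
    have key := (aux_pv (α / 2) m P hs0 hs1 hP).const_mul (cAlpha α * Q ^ (α / 2))
    have hval : cAlpha α * Q ^ (α / 2) *
        (-(P ^ (α / 2) * (Real.Gamma (α / 2) * Real.Gamma (1 - α / 2)))) = -‖z‖ ^ α := by
      have h1 : Q ^ (α / 2) * P ^ (α / 2) = ‖z‖ ^ α := by
        rw [← Real.mul_rpow hQ.le hP.le, hPd, mul_div_cancel₀ _ hQ.ne', ← Real.rpow_two,
          ← Real.rpow_mul hz0.le]
        congr 1; ring
      calc _ = -((Q ^ (α / 2) * P ^ (α / 2)) *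
            (cAlpha α * (Real.Gamma (α / 2) * Real.Gamma (1 - α / 2)))) := by ring
        _ = _ := by rw [hc, h1, mul_one]
    rw [hval] at key
    refine key.congr ?_
    intro ε
    rw [← integral_const_mul]
    congr 1
    ext w
    rw [hS, hS0, show 2 * (α / 2) = α by ring]
    ring
  · exact (integrable_const (-1 : ℝ)).congr (hae.mono fun z hz => hz.symm)
  · rw [integral_congr_ae hae, integral_const, smul_eq_mul, mul_neg_one, Measure.real]
    congr 2
    exact (measure_eq_measure_of_null_sdiff (subset_univ _)
      (by rw [← compl_eq_univ_sdiff]; exact hμ)).symm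
end
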